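/- Let V be an r-dimensional vector space and 𝓕 a generic point of Fl(V)^s. Suppose S ⊆ V is a subspace of dimension d and 𝓚=(K^1,…,K^s) is the unique s-tuple of subsets of [r], each of cardinality d, such that S ∈ ∩_{j=1}^{s} Ω°_{K^j}(F^j_•). Then: (1) dim(S,V,𝓕) ≥ 0; and (2) ∏_{j=1}^{s} ω_{K^j} ≠ 0 in H*(Gr(d,V)). -/

import Mathlib

noncomputable section

open Module Submodule

/-! ### Polynomial functions and the Zariski topology on a vector space -/

/-- Evaluation of a polynomial in linear functionals at a point of a vector space.
These are exactly the polynomial functions on a finite-dimensional vector space. -/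
def mEval (k : Type*) {M : Type*} [Field k] [AddCommGroup M] [Module k M]
    (x : M) (p : MvPolynomial (Module.Dual k M) k) : k :=
  MvPolynomial.eval (fun l : Module.Dual k M => l x) p

/-- The Zariski topology on a (finite-dimensional) vector space, generated by the
complements of zero sets of polynomial functions. -/
def mZariski (k M : Type*) [Field k] [AddCommGroup M] [Module k M] :
    TopologicalSpace M :=
  TopologicalSpace.generateFrom
    {U : Set M | ∃ p : MvPolynomial (Module.Dual k M) k, U = {x : M | mEval k x p ≠ 0}}

/-- The Zariski tangent space at a point `x` to a subset `A` of a vector space: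
the common kernel of the differentials at `x` of all polynomial functions vanishing on `A`. -/
def mTangent (k : Type*) {M : Type*} [Field k] [AddCommGroup M] [Module k M]
    (A : Set M) (x : M) : Submodule k M :=
  letI := Classical.decEq (Module.Dual k M)
  ⨅ p ∈ {p : MvPolynomial (Module.Dual k M) k | ∀ a ∈ A, mEval k a p = 0},
    LinearMap.ker (∑ l ∈ p.vars, mEval k x (MvPolynomial.pderiv l p) • (l : Module.Dual k M))

/-- `f : M → N` is a polynomial map on a subset `A ⊆ M`. -/
def IsPolyOn (k : Type*) {M N : Type*} [Field k] [AddCommGroup M] [Module k M]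
    [AddCommGroup N] [Module k N] (A : Set M) (f : M → N) : Prop :=
  ∀ l : Module.Dual k N, ∃ p : MvPolynomial (Module.Dual k M) k, ∀ x ∈ A, l (f x) = mEval k x p

/-- Dimension (topological Krull dimension) of a subset of a topological space. -/
def subDim {α : Type*} (t : TopologicalSpace α) (C : Set α) : WithBot ℕ∞ :=
  @topologicalKrullDim C (TopologicalSpace.induced (Subtype.val : C → α) t)

/-- The irreducible components of a subset `A` of a topological space
(for the subspace topology). -/
def subComponents {α : Type*} (t : TopologicalSpace α) (A : Set α) : Set (Set ↥A) :=
  @irreducibleComponents A (TopologicalSpace.induced (Subtype.val : A → α) t)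

/-- Dimension of a subset `C` of a subspace `A` of a topological space. -/
def compDim {α : Type*} (t : TopologicalSpace α) (A : Set α) (C : Set ↥A) : WithBot ℕ∞ :=
  subDim (TopologicalSpace.induced (Subtype.val : A → α) t) C

/-! ### Flags, Schubert cells and Schubert varieties -/

/-- A complete flag on a finite-dimensional vector space, recorded as the increasing
function sending `m` to the `m`-th member (of dimension `m`) of the flag. -/
def IsFlag {k M : Type*} [Field k] [AddCommGroup M] [Module k M]
    (E : ℕ → Submodule k M) : Prop :=
  Monotone E ∧ ∀ m : ℕ, finrank k ↥(E m) = min m (finrank k M)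

/-- Membership of `V` in the (open) Schubert cell `Ω°_I(E_•) ⊆ Gr(r, M)` attached to the
subset `I ⊆ [n]` recorded by the strictly increasing tuple `i : Fin r → Fin n`
(`0`-indexed: the `1`-based subset is `{i a + 1}`): `dim (V ∩ E_u) = #{a | i_a ≤ u}`. -/
def cellMem {k M : Type*} [Field k] [AddCommGroup M] [Module k M] {n r : ℕ}
    (i : Fin r → Fin n) (E : ℕ → Submodule k M) (V : Submodule k M) : Prop :=
  finrank k ↥V = r ∧
    ∀ u : ℕ, u ≤ n →
      finrank k ↥(V ⊓ E u) =
        (Finset.univ.filter (fun a : Fin r => (i a : ℕ) + 1 ≤ u)).card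

/-- Membership of `V` in the (closed) Schubert variety `Ω_I(E_•) ⊆ Gr(r, M)`:
`dim (V ∩ E_{i_a}) ≥ a` for `a = 1, …, r`. -/
def varMem {k M : Type*} [Field k] [AddCommGroup M] [Module k M] {n r : ℕ}
    (i : Fin r → Fin n) (E : ℕ → Submodule k M) (V : Submodule k M) : Prop :=
  finrank k ↥V = r ∧ ∀ a : Fin r, (a : ℕ) + 1 ≤ finrank k ↥(V ⊓ E ((i a : ℕ) + 1))

/-- The flag induced on a subspace `V` by a flag `E` on `M`: its `a`-th member is the
smallest subspace of the form `V ∩ E_u` of dimension `≥ a`. -/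
def indSub {k M : Type*} [Field k] [AddCommGroup M] [Module k M]
    (E : ℕ → Submodule k M) (V : Submodule k M) : ℕ → Submodule k ↥V := fun a =>
  ⨅ u ∈ {u : ℕ | a ≤ finrank k ↥(Submodule.comap V.subtype (E u))},
    Submodule.comap V.subtype (E u)

/-- The flag induced on the quotient `M ⧸ V` by a flag `E` on `M`: its `b`-th member is
the smallest subspace of the form `(E_u + V)/V` of dimension `≥ b`. -/
def indQuot {k M : Type*} [Field k] [AddCommGroup M] [Module k M]
    (E : ℕ → Submodule k M) (V : Submodule k M) : ℕ → Submodule k (M ⧸ V) := fun b =>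
  ⨅ u ∈ {u : ℕ | b ≤ finrank k ↥(Submodule.map V.mkQ (E u))},
    Submodule.map V.mkQ (E u)

/-- The flag spanned by a tuple of vectors (a complete flag when the tuple is a basis). -/
def spanFlag (k : Type*) {M : Type*} [Field k] [AddCommGroup M] [Module k M] {r : ℕ}
    (b : Fin r → M) : ℕ → Submodule k M := fun m =>
  Submodule.span k (b '' {a : Fin r | (a : ℕ) < m})

/-- `P` holds for a generic point of `Fl(M)^s` (`r = dim M`): there is a nonempty Zariski
open set of `s`-tuples of bases of `M` on which the associated tuples of complete flags
satisfy `P`. -/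
def GenericFlags (k : Type*) {M : Type*} [Field k] [AddCommGroup M] [Module k M]
    (s r : ℕ) (P : (Fin s → ℕ → Submodule k M) → Prop) : Prop :=
  ∃ U : Set (Fin s → Fin r → M),
    @IsOpen _ (mZariski k (Fin s → Fin r → M)) U ∧
    (∃ b ∈ U, ∀ j, LinearIndependent k (b j)) ∧
    ∀ b ∈ U, (∀ j, LinearIndependent k (b j)) → P (fun j => spanFlag k (b j))

/-- `P` holds for a generic point of `Fl(M)^s × Fl(Q)^s` (`r = dim M`, `q = dim Q`). -/
def GenericFlagPairs (k : Type*) {M Q : Type*} [Field k] [AddCommGroup M] [Module k M]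
    [AddCommGroup Q] [Module k Q] (s r q : ℕ)
    (P : (Fin s → ℕ → Submodule k M) → (Fin s → ℕ → Submodule k Q) → Prop) : Prop :=
  ∃ U : Set ((Fin s → Fin r → M) × (Fin s → Fin q → Q)),
    @IsOpen _ (mZariski k ((Fin s → Fin r → M) × (Fin s → Fin q → Q))) U ∧
    (∃ b ∈ U, (∀ j, LinearIndependent k (b.1 j)) ∧ ∀ j, LinearIndependent k (b.2 j)) ∧
    ∀ b ∈ U, ((∀ j, LinearIndependent k (b.1 j)) ∧ ∀ j, LinearIndependent k (b.2 j)) →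
      P (fun j => spanFlag k (b.1 j)) (fun j => spanFlag k (b.2 j))

/-! ### The spaces `Hom_𝓘(V, Q, 𝓕, 𝓖)` -/

/-- The subspace `{φ : M →ₗ Q | φ(p) ⊆ q}` of `Hom(M, Q)`. -/
def homConstraint {k M Q : Type*} [Field k] [AddCommGroup M] [Module k M]
    [AddCommGroup Q] [Module k Q] (p : Submodule k M) (q : Submodule k Q) :
    Submodule k (M →ₗ[k] Q) :=
  LinearMap.ker ((LinearMap.llcomp k ↥p Q (Q ⧸ q) q.mkQ).comp (LinearMap.lcomp k Q p.subtype))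

/-- `Hom_𝓘(M, Q, F, G) = {φ | φ(F^j_a) ⊆ G^j_{i^j_a - a} for all a = 1, …, r, j = 1, …, s}`. -/
def homSpace {k M Q : Type*} [Field k] [AddCommGroup M] [Module k M]
    [AddCommGroup Q] [Module k Q] {n r s : ℕ} (I : Fin s → Fin r → Fin n)
    (F : Fin s → ℕ → Submodule k M) (G : Fin s → ℕ → Submodule k Q) :
    Submodule k (M →ₗ[k] Q) :=
  ⨅ j : Fin s, ⨅ a : Fin r,
    homConstraint (F j ((a : ℕ) + 1)) (G j ((I j a : ℕ) - (a : ℕ)))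

/-! ### Charts on the Grassmannian, tangent spaces to Schubert cells -/

/-- The graph of `ψ : V →ₗ C`, a point of the Grassmannian chart around `V`
determined by a complement `C` of `V`. -/
def graphMap {k M : Type*} [Field k] [AddCommGroup M] [Module k M]
    (V C : Submodule k M) (ψ : ↥V →ₗ[k] ↥C) : Submodule k M :=
  LinearMap.range (V.subtype + C.subtype ∘ₗ ψ)

/-- The canonical identification `Hom(V, C) ≃ Hom(V, M/V)` (derivative of the chart). -/
def conjMap {k M : Type*} [Field k] [AddCommGroup M] [Module k M]
    (V C : Submodule k M) : (↥V →ₗ[k] ↥C) →ₗ[k] (↥V →ₗ[k] M ⧸ V) :=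
  LinearMap.llcomp k ↥V ↥C (M ⧸ V) (V.mkQ ∘ₗ C.subtype)

/-- The tangent space at `V` to a set `S` of points of the Grassmannian `Gr(r, M)`,
computed in the chart determined by a complement `C` of `V` and viewed inside
`Hom(V, M/V)` via the canonical identification. -/
def grTangent {k M : Type*} [Field k] [AddCommGroup M] [Module k M]
    (S : Set (Submodule k M)) (V C : Submodule k M) :
    Submodule k (↥V →ₗ[k] (M ⧸ V)) :=
  Submodule.map (conjMap V C)
    (mTangent k {ψ : ↥V →ₗ[k] ↥C | graphMap V C ψ ∈ S} 0)

/-- The Zariski topology on the Grassmannian of `r`-dimensional subspaces of `M`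
(as a topology on `Submodule k M`), coinduced from the Stiefel parameterization by
spanning `r`-tuples. -/
def grTop (k : Type*) {M : Type*} [Field k] [AddCommGroup M] [Module k M] (r : ℕ) :
    TopologicalSpace (Submodule k M) :=
  TopologicalSpace.coinduced (fun b : Fin r → M => Submodule.span k (Set.range b))
    (mZariski k (Fin r → M))

/-! ### Numerical quantities -/

/-- `codim ω_I = ∑_{a=1}^r (n - r + a - i_a)` (as an integer). -/
def codimZ (n r : ℕ) (i : Fin r → Fin n) : ℤ :=
  ∑ a : Fin r, ((n : ℤ) - (r : ℤ) + ((a : ℕ) : ℤ) - ((i a : ℕ) : ℤ))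

/-- The quantity `∑_j ∑_{a ∈ K^j} (n - r + a - i^j_a) - d(n - r)` of Inequality `(†^𝓘_𝓚)`. -/
def daggerZ (n r d : ℕ) {s : ℕ} (I : Fin s → Fin r → Fin n)
    (K : Fin s → Fin d → Fin r) : ℤ :=
  (∑ j : Fin s, ∑ t : Fin d,
      ((n : ℤ) - (r : ℤ) + ((K j t : ℕ) : ℤ) - ((I j (K j t) : ℕ) : ℤ)))
    - (d : ℤ) * ((n : ℤ) - (r : ℤ))

/-- The expected dimension `dim(S, M, 𝓕) = d(m - d) - ∑_j ∑_{t=1}^d (m - d + t - k^j_t)`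
of an intersection of Schubert cells `Ω°_{K^j}` in `Gr(d, m)`. -/
def eDimZ {s : ℕ} (m d : ℕ) (K : Fin s → Fin d → Fin m) : ℤ :=
  (d : ℤ) * ((m : ℤ) - (d : ℤ)) -
    ∑ j : Fin s, ∑ t : Fin d,
      ((m : ℤ) - (d : ℤ) + ((t : ℕ) : ℤ) - ((K j t : ℕ) : ℤ))

/-- `codim ω_I` as a natural number. -/
def codimN (n r : ℕ) (i : Fin r → Fin n) : ℕ :=
  ∑ a : Fin r, ((n - r + (a : ℕ)) - (i a : ℕ))

/-! ### The cohomology ring of the Grassmannian, Schubert classes -/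

/-- The ideal `(h_{n-r+1}, …, h_n)` of the polynomial ring in `r` variables
(`h_m` the complete homogeneous symmetric polynomials). -/
def grassIdeal (r n : ℕ) : Ideal (MvPolynomial (Fin r) ℤ) :=
  Ideal.span ((fun m : ℕ => MvPolynomial.hsymm (Fin r) ℤ m) '' Set.Icc (n - r + 1) n)

/-- A presentation of the cohomology (Chow) ring `H^*(Gr(r,n))`: products of Schubert
classes vanish here exactly when they vanish in `H^*(Gr(r,n))`. -/
abbrev grassRing (r n : ℕ) : Type :=
  MvPolynomial (Fin r) ℤ ⧸ grassIdeal r n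

/-- `h_m` for an integer `m` (zero for negative `m`). -/
def hkZ (r : ℕ) (m : ℤ) : MvPolynomial (Fin r) ℤ :=
  if 0 ≤ m then MvPolynomial.hsymm (Fin r) ℤ m.toNat else 0

/-- The Schur polynomial (Jacobi–Trudi determinant) of the partition
`λ_a = n - r + a - i_a` attached to the subset `I ⊆ [n]` recorded by `i`. -/
def schurI {n r : ℕ} (i : Fin r → Fin n) : MvPolynomial (Fin r) ℤ :=
  Matrix.det (Matrix.of fun a b : Fin r =>
    hkZ r ((n : ℤ) - (r : ℤ) + ((b : ℕ) : ℤ) - ((i a : ℕ) : ℤ)))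

/-- The Schubert class `ω_I ∈ H^*(Gr(r,n))` of the subset `I ⊆ [n]` recorded by the
strictly increasing tuple `i : Fin r → Fin n`. -/
def omegaCls {n r : ℕ} (i : Fin r → Fin n) : grassRing r n :=
  Ideal.Quotient.mk (grassIdeal r n) (schurI i)

/-- The class of a point in `H^*(Gr(r,n))`: the Schubert class of `I = {1, …, r}`. -/
def pointCls (r n : ℕ) (h : r ≤ n) : grassRing r n :=
  omegaCls (fun a : Fin r => Fin.castLE h a)

/-! ### Schur polynomials of partitions, Littlewood–Richardson coefficients -/

/-- The Schur polynomial of a partition with at most `r` parts, via Jacobi–Trudi. -/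
def schurP {r : ℕ} (lam : Fin r → ℕ) : MvPolynomial (Fin r) ℤ :=
  Matrix.det (Matrix.of fun a b : Fin r =>
    hkZ r (((lam a : ℕ) : ℤ) - ((a : ℕ) : ℤ) + ((b : ℕ) : ℤ)))

/-- The Vandermonde alternant `a_δ = det(x_a^{r-1-b})`. -/
def alternant (r : ℕ) : MvPolynomial (Fin r) ℤ :=
  Matrix.det (Matrix.of fun a b : Fin r => (MvPolynomial.X a) ^ (r - 1 - (b : ℕ)))

/-- The coefficient of the Schur polynomial `s_δ` in a symmetric polynomial `f`
(in `r` variables): the coefficient of the monomial `x^{δ + (r-1, …, 1, 0)}` in `f ⬝ a_δ`. -/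
def schurCoeff (r : ℕ) (f : MvPolynomial (Fin r) ℤ) (δ : Fin r → ℕ) : ℤ :=
  MvPolynomial.coeff
    (Finsupp.equivFunOnFinite.symm (fun a : Fin r => δ a + (r - 1 - (a : ℕ))))
    (f * alternant r)

/-- The Littlewood–Richardson coefficient `c^λ_{μ,ν}` (partitions with at most `r` parts):
the multiplicity of `V_λ` in `V_μ ⊗ V_ν`, i.e. of `s_λ` in `s_μ s_ν`. -/
def lrCoeff (r : ℕ) (lam mu nu : Fin r → ℕ) : ℤ :=
  schurCoeff r (schurP mu * schurP nu) lam

/-- The multiplicity of `V_δ` in `V_{Λ 1} ⊗ ⋯ ⊗ V_{Λ t}` (as `GL(r)`-representations),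
i.e. of `s_δ` in `∏_j s_{Λ j}`. -/
def multiCoeff (r : ℕ) {t : ℕ} (Λ : Fin t → Fin r → ℕ) (δ : Fin r → ℕ) : ℤ :=
  schurCoeff r (∏ j : Fin t, schurP (Λ j)) δ

namespace SchubertAlg

open MvPolynomial

/-- The geometric power series `∑ aⁿ tⁿ`. -/
def geomSer {R : Type*} [CommRing R] (a : R) : PowerSeries R := PowerSeries.mk fun n => a ^ n

lemma geomSer_mul {R : Type*} [CommRing R] (a : R) :
    (1 - PowerSeries.C a * PowerSeries.X) * geomSer a = 1 := by
  ext n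
  rcases n with _ | n
  · simp [sub_mul, geomSer, mul_assoc]
  · simp [sub_mul, geomSer, mul_assoc, PowerSeries.coeff_succ_X_mul, pow_succ', PowerSeries.coeff_one]

lemma mk_hsymm (d : ℕ) :
    PowerSeries.mk (fun n => hsymm (Fin d) ℤ n) = ∏ i : Fin d, geomSer (X i : MvPolynomial (Fin d) ℤ) := by
  classical
  ext1 n
  rw [PowerSeries.coeff_prod, PowerSeries.coeff_mk, hsymm]
  simp only [geomSer, PowerSeries.coeff_mk]
  refine Finset.sum_bij (fun s _ => Multiset.toFinsupp (s : Multiset (Fin d))) ?_ ?_ ?_ ?_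
  · intro s _
    simp only [Finset.mem_finsuppAntidiag, Finset.subset_univ, and_true]
    exact (Multiset.sum_count_eq_card (m := s.1) fun a _ => Finset.mem_univ a).trans s.2
  · intro s _ t _ h
    exact Subtype.ext (Multiset.toFinsupp.injective h)
  · intro l hl
    simp only [Finset.mem_finsuppAntidiag, Finset.subset_univ, and_true] at hl
    refine ⟨⟨Finsupp.toMultiset l, ?_⟩, Finset.mem_univ _, ?_⟩
    · rw [Finsupp.card_toMultiset, Finsupp.sum_fintype _ _ (fun _ => rfl)]; simpa using hl
    · simp
  · intro s _
    simp only [Multiset.toFinsupp_apply]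
    rw [Finset.prod_multiset_map_count]
    refine Finset.prod_subset (Finset.subset_univ _) fun x _ hx => ?_
    rw [Multiset.count_eq_zero_of_notMem (by simpa using hx), pow_zero]

/-- The alternant `det (x_i ^ n_a)`. -/
def alt (R : Type*) [CommRing R] {d : ℕ} (n : Fin d → ℕ) : MvPolynomial (Fin d) R :=
  Matrix.det (Matrix.of fun a i : Fin d => (X i : MvPolynomial (Fin d) R) ^ n a)

/-- The exponents `(d-1, …, 1, 0)`. -/
def stair (d : ℕ) (a : Fin d) : ℕ := d - 1 - a

/-- The polynomial `∏_{j ≠ i} (1 - x_j t)` in `t`. -/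
def coProd {d : ℕ} (i : Fin d) : Polynomial (MvPolynomial (Fin d) ℤ) :=
  ∏ j ∈ Finset.univ.erase i, (1 - Polynomial.C (X j) * Polynomial.X)

lemma natDegree_coProd {d : ℕ} (i : Fin d) : (coProd i).natDegree ≤ d - 1 := by
  refine (Polynomial.natDegree_prod_le _ _).trans ?_
  refine (Finset.sum_le_card_nsmul _ _ 1 fun j _ => ?_).trans ?_
  · compute_degree
  · simp

lemma mk_hsymm_mul_coProd {d : ℕ} (i : Fin d) :
    (coProd i : PowerSeries (MvPolynomial (Fin d) ℤ)) *
      PowerSeries.mk (fun n => hsymm (Fin d) ℤ n) = geomSer (X i) := by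
  have h : (coProd i : PowerSeries (MvPolynomial (Fin d) ℤ)) =
      ∏ j ∈ Finset.univ.erase i, (1 - PowerSeries.C (X j) * PowerSeries.X) := by
    rw [coProd, ← Polynomial.coeToPowerSeries.ringHom_apply, map_prod]
    simp
  rw [h, mk_hsymm, ← Finset.mul_prod_erase _ _ (Finset.mem_univ i), mul_left_comm,
    ← Finset.prod_mul_distrib]
  simp [geomSer_mul]

lemma hkZ_natCast (d n : ℕ) : hkZ d n = hsymm (Fin d) ℤ n := by simp [hkZ]

lemma hkZ_of_neg (d : ℕ) {n : ℤ} (h : n < 0) : hkZ d n = 0 := by simp [hkZ, h]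

lemma X_pow_eq_sum {d : ℕ} (i : Fin d) (n : ℕ) :
    (X i : MvPolynomial (Fin d) ℤ) ^ n =
      ∑ b : Fin d, hkZ d ((n : ℤ) - ((d : ℤ) - 1) + ((b : ℕ) : ℤ)) * (coProd i).coeff (d - 1 - b) := by
  have h := congrArg (PowerSeries.coeff n) (mk_hsymm_mul_coProd i)
  rw [geomSer, PowerSeries.coeff_mk, PowerSeries.coeff_mul] at h
  rw [← h, Finset.Nat.sum_antidiagonal_eq_sum_range_succ_mk]
  simp only [Polynomial.coeff_coe, PowerSeries.coeff_mk]
  have hd : 0 < d := i.pos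
  have key : ∀ q : ℕ, (coProd i).coeff q * hkZ d ((n : ℤ) - q) ≠ 0 → q < d ∧ q ≤ n := by
    intro q hq
    refine ⟨?_, ?_⟩
    · by_contra hc
      exact hq (by rw [Polynomial.coeff_eq_zero_of_natDegree_lt
        (by have := natDegree_coProd i; omega), zero_mul])
    · by_contra hc
      exact hq (by rw [hkZ_of_neg _ (by omega), mul_zero])
  trans ∑ q ∈ Finset.range d, (coProd i).coeff q * hkZ d ((n : ℤ) - q)
  · trans ∑ q ∈ Finset.range (n + 1), (coProd i).coeff q * hkZ d ((n : ℤ) - q)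
    · refine Finset.sum_congr rfl fun q hq => ?_
      rw [Finset.mem_range] at hq
      rw [← Nat.cast_sub (by omega), hkZ_natCast]
    · refine (Finset.sum_subset (Finset.range_subset_range.2 (le_max_left (n + 1) d)) ?_).trans
        (Finset.sum_subset (Finset.range_subset_range.2 (le_max_right (n + 1) d)) ?_).symm
      · intro q _ hq
        by_contra hc
        exact hq (by have := key q hc; simp; omega)
      · intro q _ hq
        by_contra hc
        exact hq (by have := key q hc; simp; omega)
  · rw [← Finset.sum_range_reflect, Finset.sum_range]
    refine Finset.sum_congr rfl fun b _ => ?_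
    rw [mul_comm]
    congr 2
    have := b.2
    omega

lemma det_hkZ_mul_aux {d : ℕ} (n : Fin d → ℕ) :
    Matrix.det (Matrix.of fun a b : Fin d => hkZ d ((n a : ℤ) - ((d : ℤ) - 1) + ((b : ℕ) : ℤ))) *
      Matrix.det (Matrix.of fun b i : Fin d => (coProd i).coeff (d - 1 - b)) = alt ℤ n := by
  rw [← Matrix.det_mul, alt]
  congr 1
  ext1 a i
  rw [Matrix.mul_apply, Matrix.of_apply, X_pow_eq_sum]
  rfl

/-- The Jacobi–Trudi determinant times the Vandermonde alternant is an alternant. -/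
lemma det_hkZ_mul_alt {d : ℕ} (n : Fin d → ℕ) :
    Matrix.det (Matrix.of fun a b : Fin d => hkZ d ((n a : ℤ) - ((d : ℤ) - 1) + ((b : ℕ) : ℤ))) *
      alt ℤ (stair d) = alt ℤ n := by
  rw [← det_hkZ_mul_aux n, ← det_hkZ_mul_aux (stair d)]
  congr 1
  rw [Matrix.det_of_isUpperTriangular, Finset.prod_eq_one, one_mul]
  · intro a _
    have : ((stair d a : ℕ) : ℤ) - ((d : ℤ) - 1) + ((a : ℕ) : ℤ) = (0 : ℕ) := by
      have := a.2; simp only [stair]; omega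
    rw [Matrix.of_apply, this, hkZ_natCast, hsymm_zero]
  · intro a b hab
    rw [Matrix.of_apply, hkZ_of_neg]
    have := a.2
    have : b < a := hab
    simp only [stair]; omega

lemma schurI_mul_alt {d r : ℕ} (K : Fin d → Fin r) :
    schurI K * alt ℤ (stair d) = alt ℤ fun a => r - 1 - K a := by
  rw [← det_hkZ_mul_alt fun a => r - 1 - (K a : ℕ), schurI]
  congr 3
  ext a b : 2
  congr 1
  have := (K a).2
  omega

/-- The ideal `(x_1 ^ r, …, x_d ^ r)`. -/
def truncIdeal (d r : ℕ) : Ideal (MvPolynomial (Fin d) ℤ) :=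
  Ideal.span (Set.range fun i => X i ^ r)

lemma hsymm_mul_alt_mem {d r m : ℕ} (hd : d ≤ r) (hd0 : 0 < d) (hm : r - d + 1 ≤ m) :
    hsymm (Fin d) ℤ m * alt ℤ (stair d) ∈ truncIdeal d r := by
  let z : Fin d := ⟨0, hd0⟩
  let n : Fin d → ℕ := Function.update (stair d) z (m + d - 1)
  have h := det_hkZ_mul_alt n
  rw [Matrix.det_of_isUpperTriangular] at h
  · rw [← Finset.mul_prod_erase _ _ (Finset.mem_univ z), Finset.prod_eq_one] at h
    · have e : ((n z : ℕ) : ℤ) - ((d : ℤ) - 1) + ((z : ℕ) : ℤ) = m := by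
        simp [n, z]; omega
      rw [Matrix.of_apply, e, hkZ_natCast, mul_one] at h
      rw [h, alt, Matrix.det_apply]
      refine Ideal.sum_mem _ fun σ _ => ?_
      rw [Units.smul_def, zsmul_eq_mul]
      refine Ideal.mul_mem_left _ _ ?_
      rw [← Finset.mul_prod_erase _ _ (Finset.mem_univ (σ.symm z))]
      refine Ideal.mul_mem_right _ _ ?_
      have : n z = r + (m + d - 1 - r) := by simp [n]; omega
      simp only [Matrix.of_apply, Equiv.apply_symm_apply, this, pow_add]
      exact Ideal.mul_mem_right _ _ (Ideal.subset_span ⟨_, rfl⟩)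
    · intro a ha
      have hz : a ≠ z := Finset.ne_of_mem_erase ha
      have e : ((n a : ℕ) : ℤ) - ((d : ℤ) - 1) + ((a : ℕ) : ℤ) = (0 : ℕ) := by
        have := a.2
        simp only [n, Function.update_of_ne hz, stair]; omega
      rw [Matrix.of_apply, e, hkZ_natCast, hsymm_zero]
  · intro a b hab
    have hab : b < a := hab
    have hz : a ≠ z := fun h => by rw [h] at hab; exact absurd hab (by simp [z, Fin.lt_def])
    rw [Matrix.of_apply, hkZ_of_neg]
    have := a.2
    simp only [n, Function.update_of_ne hz, stair]; omega

lemma mul_alt_mem_truncIdeal {d r : ℕ} (hd : d ≤ r) (hd0 : 0 < d) {f : MvPolynomial (Fin d) ℤ}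
    (hf : f ∈ grassIdeal d r) : f * alt ℤ (stair d) ∈ truncIdeal d r := by
  refine Submodule.span_induction (p := fun f _ => f * alt ℤ (stair d) ∈ truncIdeal d r)
    ?_ ?_ ?_ ?_ hf
  · rintro _ ⟨m, hm, rfl⟩
    exact hsymm_mul_alt_mem hd hd0 hm.1
  · simp
  · intro f g _ _ hf hg
    rw [add_mul]; exact Ideal.add_mem _ hf hg
  · intro c f _ hf
    rw [smul_eq_mul, mul_assoc]; exact Ideal.mul_mem_left _ _ hf

lemma coeff_eq_zero_of_mem_truncIdeal {d r : ℕ} {f : MvPolynomial (Fin d) ℤ}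
    (hf : f ∈ truncIdeal d r) (n : Fin d →₀ ℕ) (hn : ∀ i, n i < r) : f.coeff n = 0 := by
  have h := Ideal.span_le (I := Ideal.span (Set.range fun i : Fin d => (X i : MvPolynomial (Fin d) ℤ) ^ r)) |>.2 Ideal.subset_span hf
  refine Submodule.span_induction (p := fun f _ => ∀ c, (c * f).coeff n = 0) ?_ ?_ ?_ ?_ h 1 |> fun h => by simpa using h
  · rintro _ ⟨i, rfl⟩ c
    dsimp only
    rw [X_pow_eq_monomial, coeff_mul_monomial']
    rw [if_neg]
    intro hle
    have := hle i
    simp at this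
    exact absurd this (by have := hn i; omega)
  · simp
  · intro f g _ _ hf hg c
    rw [mul_add, coeff_add, hf, hg, add_zero]
  · intro a f _ hf c
    rw [smul_eq_mul, ← mul_assoc]; exact hf _

/-- If a product of Schubert classes vanishes, then so do all the coefficients of the product of
the Schur polynomials with the Vandermonde alternant at exponents `< r`. -/
lemma coeff_prod_schurI_mul_alt {d r s : ℕ} (hd : d ≤ r) (hd0 : 0 < d) (K : Fin s → Fin d → Fin r)
    (h : ∏ j, omegaCls (K j) = (0 : grassRing d r)) (n : Fin d →₀ ℕ) (hn : ∀ i, n i < r) :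
    ((∏ j, schurI (K j)) * alt ℤ (stair d)).coeff n = 0 := by
  refine coeff_eq_zero_of_mem_truncIdeal (mul_alt_mem_truncIdeal hd hd0 ?_) n hn
  rw [← Ideal.Quotient.eq_zero_iff_mem, map_prod]
  exact h

end SchubertAlg

namespace SchubertAlg

open MvPolynomial

/-- The Euler operator `x_i ∂/∂x_i`. -/
def eul (R : Type*) [CommRing R] {d : ℕ} (i : Fin d) :
    Derivation R (MvPolynomial (Fin d) R) (MvPolynomial (Fin d) R) :=
  (X i : MvPolynomial (Fin d) R) • pderiv i

variable {K : Type*} [Field K] {d : ℕ}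

lemma eul_monomial (i : Fin d) (n : Fin d →₀ ℕ) (c : K) :
    eul K i (monomial n c) = monomial n (n i * c) := by
  rw [eul, Derivation.smul_apply, smul_eq_mul, X_mul_pderiv_monomial, ← map_nsmul, nsmul_eq_mul]

lemma coeff_eul (i : Fin d) (n : Fin d →₀ ℕ) (f : MvPolynomial (Fin d) K) :
    coeff n (eul K i f) = n i * coeff n f := by
  induction f using MvPolynomial.induction_on' with
  | monomial m c =>
    rw [eul_monomial, coeff_monomial, coeff_monomial]
    split_ifs with h <;> simp [h]
  | add p q hp hq => rw [map_add, coeff_add, coeff_add, hp, hq, mul_add]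

lemma eul_X (i j : Fin d) : eul K i (X j) = if i = j then X i else 0 := by
  rw [eul, Derivation.smul_apply, pderiv_X, smul_eq_mul]
  by_cases h : i = j
  · simp [h]
  · simp [h, Ne.symm h]

lemma derivation_prod {A ι : Type*} [CommRing A] [Algebra K A] [DecidableEq ι]
    (D : Derivation K A A) (s : Finset ι) (f : ι → A) :
    D (∏ p ∈ s, f p) = ∑ p ∈ s, (∏ q ∈ s.erase p, f q) * D (f p) := by
  induction s using Finset.induction_on with
  | empty => simp
  | insert a s ha ih =>
    rw [Finset.prod_insert ha, D.leibniz, ih, Finset.sum_insert ha, Finset.erase_insert ha,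
      smul_eq_mul, smul_eq_mul, Finset.mul_sum, add_comm]
    congr 1
    refine Finset.sum_congr rfl fun p hp => ?_
    rw [Finset.erase_insert_of_ne (by rintro rfl; exact ha hp), Finset.prod_insert
      (by simp [ha]), mul_assoc]

lemma alt_stair (K : Type*) [Field K] (d : ℕ) :
    alt K (stair d) = ∏ p ∈ (Finset.univ : Finset (Fin d × Fin d)).filter (fun p => p.1 < p.2),
      (X p.1 - X p.2) := by
  have h := Matrix.det_projVandermonde (n := d) (fun _ => (1 : MvPolynomial (Fin d) K)) X
  rw [alt, ← Matrix.det_transpose]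
  trans (Matrix.projVandermonde (fun _ => (1 : MvPolynomial (Fin d) K)) X).det
  · congr 1
    ext1 i j
    simp only [Matrix.transpose_apply, Matrix.of_apply, Matrix.projVandermonde_apply, one_pow,
      one_mul, stair, Fin.val_rev]
    congr 1
    omega
  · rw [h, Finset.prod_filter, ← Finset.univ_product_univ, Finset.prod_product]
    refine Finset.prod_congr rfl fun i _ => ?_
    rw [← Finset.prod_filter]
    refine Finset.prod_congr ?_ fun j _ => by ring
    ext j; simp

/-- Logarithmic derivatives of the Vandermonde alternant. -/
lemma exists_alt_stair_div (K : Type*) [Field K] (d : ℕ) :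
    ∃ A : Fin d → Fin d → MvPolynomial (Fin d) K,
      (∀ i j, i ≠ j → (X i - X j) * A i j = alt K (stair d)) ∧
      (∀ i j, A i j = - A j i) ∧ (∀ i, A i i = 0) ∧
      ∀ i, eul K i (alt K (stair d)) = ∑ j, X i * A i j := by
  classical
  set S := (Finset.univ : Finset (Fin d × Fin d)).filter (fun p => p.1 < p.2) with hS
  let B : Fin d × Fin d → MvPolynomial (Fin d) K := fun p => ∏ q ∈ S.erase p, (X q.1 - X q.2)
  refine ⟨fun i j => if i < j then B (i, j) else if j < i then - B (j, i) else 0, ?_, ?_, ?_, ?_⟩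
  · intro i j hij
    rw [alt_stair, ← hS]
    dsimp only
    rcases lt_or_gt_of_ne hij with h | h
    · rw [if_pos h, Finset.mul_prod_erase S (fun q => (X q.1 - X q.2 : MvPolynomial (Fin d) K)) (a := (i, j))]
      simp [hS, h]
    · rw [if_neg h.not_gt, if_pos h, ← Finset.mul_prod_erase S _ (a := (j, i))]
      · simp only [B]; ring
      · simp [hS, h]
  · intro i j
    rcases lt_trichotomy i j with h | h | h
    · simp [h, h.not_gt]
    · simp [h]
    · simp [h, h.not_gt]
  · simp
  · intro i
    rw [alt_stair, ← hS, derivation_prod]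
    have : ∀ p ∈ S, (∏ q ∈ S.erase p, (X q.1 - X q.2 : MvPolynomial (Fin d) K)) *
        eul K i (X p.1 - X p.2) = (if i = p.1 then X i * B p else 0) - (if i = p.2 then X i * B p else 0) := by
      intro p _
      rw [map_sub, eul_X, eul_X]
      simp only [B]
      split_ifs <;> ring
    have h1 : ∑ p ∈ S, (if i = p.1 then X i * B p else 0) =
        ∑ j, if i < j then X i * B (i, j) else 0 := by
      rw [hS, Finset.sum_filter, ← Finset.univ_product_univ, Finset.sum_product,
        Finset.sum_eq_single i (fun j _ hj => by simp [Ne.symm hj]) (by simp)]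
      simp
    have h2 : ∑ p ∈ S, (if i = p.2 then X i * B p else 0) =
        ∑ j, if j < i then X i * B (j, i) else 0 := by
      rw [hS, Finset.sum_filter, ← Finset.univ_product_univ, Finset.sum_product_right,
        Finset.sum_eq_single i (fun j _ hj => by simp [Ne.symm hj]) (by simp)]
      simp
    rw [Finset.sum_congr rfl this, Finset.sum_sub_distrib, h1, h2, ← Finset.sum_sub_distrib]
    refine Finset.sum_congr rfl fun j _ => ?_
    rcases lt_trichotomy i j with h | h | h
    · simp [h, h.not_gt]
    · simp [h]
    · simp [h, h.not_gt]

/-- The square norm of an exponent vector. -/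
def nsq {d : ℕ} (n : Fin d → ℕ) : ℕ := ∑ i, n i ^ 2

lemma alt_eq_sum (R : Type*) [CommRing R] {d : ℕ} (n : Fin d → ℕ) :
    alt R n = ∑ σ : Equiv.Perm (Fin d),
      monomial (Finsupp.equivFunOnFinite.symm (n ∘ σ)) ((Equiv.Perm.sign σ : ℤ) : R) := by
  rw [alt, Matrix.det_apply]
  refine Finset.sum_congr rfl fun σ _ => ?_
  rw [monomial_eq, Finsupp.prod_fintype _ _ (fun _ => pow_zero _), Units.smul_def, zsmul_eq_mul]
  congr 1

lemma coeff_alt_ne_zero {n : Fin d → ℕ} {m : Fin d →₀ ℕ} (h : coeff m (alt K n) ≠ 0) :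
    ∃ σ : Equiv.Perm (Fin d), (m : Fin d → ℕ) = n ∘ σ := by
  rw [alt_eq_sum, coeff_sum] at h
  obtain ⟨σ, _, hσ⟩ := Finset.exists_ne_zero_of_sum_ne_zero h
  rw [coeff_monomial] at hσ
  refine ⟨σ, ?_⟩
  by_contra hc
  refine hσ (if_neg fun h => hc ?_)
  rw [← h]; rfl

lemma nsq_comp_perm (n : Fin d → ℕ) (σ : Equiv.Perm (Fin d)) : nsq (n ∘ σ) = nsq n :=
  Equiv.sum_comp σ fun i => n i ^ 2

/-- Alternants are eigenvectors of the Laplacian. -/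
lemma nsq_mul_coeff_alt (n : Fin d → ℕ) (m : Fin d →₀ ℕ) :
    (nsq m : K) * coeff m (alt K n) = nsq n * coeff m (alt K n) := by
  by_cases h : coeff m (alt K n) = 0
  · simp [h]
  · obtain ⟨σ, hσ⟩ := coeff_alt_ne_zero h
    rw [hσ, nsq_comp_perm]

lemma coeff_sum_eul_eul (n : Fin d →₀ ℕ) (f : MvPolynomial (Fin d) K) :
    coeff n (∑ i, eul K i (eul K i f)) = nsq n * coeff n f := by
  simp only [coeff_sum, coeff_eul, nsq, Nat.cast_sum, Nat.cast_pow, Finset.sum_mul]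
  exact Finset.sum_congr rfl fun i _ => by ring

lemma sum_eul_eul_alt (n : Fin d → ℕ) :
    ∑ i, eul K i (eul K i (alt K n)) = (nsq n : K) • alt K n := by
  ext m
  rw [coeff_sum_eul_eul, coeff_smul, smul_eq_mul, nsq_mul_coeff_alt]

/-- The radial part of the Laplacian. -/
lemma sum_eul_eul_alt_mul (f : MvPolynomial (Fin d) K) (T : Fin d → Fin d → MvPolynomial (Fin d) K)
    (hT : ∀ i j, i ≠ j → (X i - X j) * T i j = X i * (eul K i f - eul K j f))
    (hTd : ∀ i, T i i = eul K i (eul K i f)) :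
    ∑ i, eul K i (eul K i (alt K (stair d) * f)) = alt K (stair d) *
      (∑ i, ∑ j, T i j + ((d : K) - 1) • ∑ i, eul K i f + (nsq (stair d) : K) • f) := by
  obtain ⟨A, hA, hanti, hdiag, heul⟩ := exists_alt_stair_div K d
  set a := alt K (stair d) with ha
  have hne : a ≠ 0 := by
    rw [ha, alt_stair]
    refine Finset.prod_ne_zero_iff.2 fun p hp => ?_
    rw [sub_ne_zero]
    exact fun h => (Finset.mem_filter.1 hp).2.ne (X_injective h)
  have h1 : ∀ i, eul K i (eul K i (a * f)) =
      eul K i (eul K i a) * f + 2 * (eul K i a * eul K i f) + a * eul K i (eul K i f) := by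
    intro i
    simp only [Derivation.leibniz, map_add, smul_eq_mul]
    ring
  have h2 : ∀ i j, a * T i j = A i j * (X i * (eul K i f - eul K j f)) +
      if i = j then a * eul K i (eul K i f) else 0 := by
    intro i j
    by_cases h : i = j
    · subst h; simp [hTd]
    · have hx : (X i - X j : MvPolynomial (Fin d) K) ≠ 0 := sub_ne_zero.2 fun h' => h (X_injective h')
      rw [if_neg h, add_zero]
      rw [← hT i j h, ← hA i j h]
      ring
  have h3 : ∑ i, ∑ j, A i j * (X i * (eul K i f - eul K j f)) +
      ((d : K) - 1) • (a * ∑ i, eul K i f) = ∑ i, 2 * (eul K i a * eul K i f) := by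
    have e1 : ∑ i, ∑ j, A i j * (X i * (eul K i f - eul K j f)) =
        ∑ i, ∑ j, A i j * (X i + X j) * eul K i f := by
      have : ∑ i, ∑ j, A i j * (X i * eul K j f) = ∑ i, ∑ j, - (A i j * (X j * eul K i f)) := by
        rw [Finset.sum_comm]
        refine Finset.sum_congr rfl fun i _ => Finset.sum_congr rfl fun j _ => ?_
        rw [hanti]; ring
      simp only [mul_sub, Finset.sum_sub_distrib]
      rw [this]
      simp only [Finset.sum_neg_distrib, sub_neg_eq_add, ← Finset.sum_add_distrib]
      refine Finset.sum_congr rfl fun i _ => Finset.sum_congr rfl fun j _ => by ring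
    have e2 : ∀ i, ∑ j, A i j * (X i + X j) * eul K i f =
        2 * (eul K i a * eul K i f) - ((d : K) - 1) • (a * eul K i f) := by
      intro i
      have : ∑ j, A i j * (X i - X j) = ((d : K) - 1) • a := by
        rw [← Finset.add_sum_erase _ _ (Finset.mem_univ i), hdiag, zero_mul, zero_add]
        rw [Finset.sum_congr rfl (g := fun _ => a) (fun j hj => by
          rw [mul_comm, hA i j (Finset.ne_of_mem_erase hj).symm])]
        rw [Finset.sum_const, Finset.card_erase_of_mem (Finset.mem_univ i), Finset.card_univ,
          Fintype.card_fin, ← Nat.cast_smul_eq_nsmul K, Nat.cast_sub (by have := i.2; omega)]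
        simp
      rw [← smul_mul_assoc, ← this, heul, Finset.sum_mul, Finset.sum_mul, Finset.mul_sum,
        ← Finset.sum_sub_distrib]
      exact Finset.sum_congr rfl fun j _ => by ring
    rw [e1, Finset.sum_congr rfl fun i _ => e2 i, Finset.sum_sub_distrib, ← Finset.smul_sum,
      ← Finset.mul_sum, ← Finset.mul_sum, sub_add_cancel]
  rw [Finset.sum_congr rfl fun i _ => h1 i, Finset.sum_add_distrib, Finset.sum_add_distrib,
    ← Finset.sum_mul, sum_eul_eul_alt, ← h3, mul_add, mul_add, Finset.mul_sum, Finset.mul_sum]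
  simp only [Finset.mul_sum, h2, Finset.sum_add_distrib, mul_smul_comm, smul_mul_assoc]
  simp only [Finset.sum_ite_eq, Finset.mem_univ, if_true]
  ring

end SchubertAlg

namespace SchubertAlg

open MvPolynomial

/-- The relations of the matrix units of `gl_d` for a family in a ring. -/
def GlRel {A : Type*} [Ring A] {d : ℕ} (E : Fin d → Fin d → A) : Prop :=
  ∀ i j k l, E i j * E k l - E k l * E i j =
    (if j = k then E i l else 0) - (if l = i then E k j else 0)

/-- The (shifted) Casimir element of a family satisfying the relations of `gl_d`. -/
def cas (K : Type*) [Field K] {A : Type*} [Ring A] [Algebra K A] {d : ℕ} (E : Fin d → Fin d → A) : A :=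
  ∑ i, ∑ j, E i j * E j i + ((d : K) - 1) • ∑ i, E i i + (nsq (stair d) : K) • 1

/-- The Casimir element is central. -/
lemma commute_cas {K : Type*} [Field K] {A : Type*} [Ring A] [Algebra K A] {d : ℕ}
    {E : Fin d → Fin d → A} (hE : GlRel E) (k l : Fin d) : Commute (E k l) (cas K E) := by
  have h1 : ∀ i j, E k l * (E i j * E j i) - (E i j * E j i) * E k l =
      ((if l = i then E k j * E j i else 0) - (if j = k then E i l * E j i else 0)) +
      ((if l = j then E i j * E k i else 0) - (if i = k then E i j * E j l else 0)) := by
    intro i j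
    have e : E k l * (E i j * E j i) - (E i j * E j i) * E k l =
      (E k l * E i j - E i j * E k l) * E j i + E i j * (E k l * E j i - E j i * E k l) := by
      noncomm_ring
    rw [e, hE, hE, sub_mul, mul_sub]
    simp only [ite_mul, mul_ite, zero_mul, mul_zero]
  have h2 : Commute (E k l) (∑ i, ∑ j, E i j * E j i) := by
    rw [commute_iff_eq, ← sub_eq_zero]
    simp only [Finset.mul_sum, Finset.sum_mul, ← Finset.sum_sub_distrib, h1]
    simp only [Finset.sum_add_distrib, Finset.sum_sub_distrib]
    rw [Finset.sum_comm (f := fun i j => if l = i then E k j * E j i else 0),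
      Finset.sum_comm (f := fun i j => if i = k then E i j * E j l else 0)]
    simp
  have h3 : Commute (E k l) (∑ i, E i i) := by
    rw [commute_iff_eq, ← sub_eq_zero]
    simp only [Finset.mul_sum, Finset.sum_mul, ← Finset.sum_sub_distrib, fun i => hE k l i i]
    simp
  exact (h2.add_right (h3.smul_right _)).add_right ((Commute.one_right _).smul_right _)

lemma nsq_add_stair {d : ℕ} (K : Type*) [Field K] (μ : Fin d → ℕ) :
    (∑ i, ∑ j, if i < j then ((μ i : K) - μ j) else 0) + ∑ i, (μ i : K) ^ 2 +
      ((d : K) - 1) * ∑ i, (μ i : K) + nsq (stair d) = nsq (fun i => μ i + stair d i) := by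
  have h : (∑ i, ∑ j, if i < j then ((μ i : K) - μ j) else 0) =
      ∑ i, (μ i : K) * (2 * (stair d i : K) - ((d : K) - 1)) := by
    have e : ∀ i j : Fin d, (if i < j then ((μ i : K) - μ j) else 0) =
        (if i < j then (μ i : K) else 0) - (if i < j then (μ j : K) else 0) := by
      intro i j; split_ifs <;> simp
    simp only [e, Finset.sum_sub_distrib]
    rw [Finset.sum_comm (f := fun i j => if i < j then (μ j : K) else 0), ← Finset.sum_sub_distrib]
    refine Finset.sum_congr rfl fun i _ => ?_
    have c1 : ∑ j, (if i < j then (μ i : K) else 0) = (stair d i : K) * μ i := by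
      rw [← Finset.sum_filter, Finset.sum_const, nsmul_eq_mul]
      congr 2
      have : Finset.univ.filter (fun j => i < j) = Finset.Ioi i := by ext; simp
      rw [this, Fin.card_Ioi, stair]
    have c2 : ∑ j, (if j < i then (μ i : K) else 0) = (i : ℕ) * μ i := by
      rw [← Finset.sum_filter, Finset.sum_const, nsmul_eq_mul]
      congr 2
      have : Finset.univ.filter (fun j => j < i) = Finset.Iio i := by ext; simp
      rw [this, Fin.card_Iio]
    rw [c1, c2]
    have : (stair d i : K) = (d : K) - 1 - (i : ℕ) := by
      rw [stair, Nat.cast_sub (by have := i.2; omega), Nat.cast_sub (by have := i.2; omega)]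
      simp
    rw [this]; ring
  rw [h, nsq, nsq]
  push_cast
  rw [Finset.mul_sum, ← Finset.sum_add_distrib, ← Finset.sum_add_distrib, ← Finset.sum_add_distrib]
  exact Finset.sum_congr rfl fun i _ => by ring

/-- The Casimir element acts on a highest weight vector by a scalar. -/
lemma cas_hw {K : Type*} [Field K] {d : ℕ} {U : Type*} [AddCommGroup U] [Module K U]
    {E : Fin d → Fin d → Module.End K U} (hE : GlRel E) (μ : Fin d → ℕ) (v : U)
    (hw : ∀ i, E i i v = (μ i : K) • v) (hv : ∀ i j, i < j → E i j v = 0) :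
    cas K E v = (nsq (fun i => μ i + stair d i) : K) • v := by
  have h1 : ∀ i j, (E i j * E j i) v =
      ((if i < j then ((μ i : K) - μ j) else 0) + if i = j then (μ i : K) ^ 2 else 0) • v := by
    intro i j
    rcases lt_trichotomy i j with h | h | h
    · have := congrArg (fun f : Module.End K U => f v) (hE i j j i)
      simp only [LinearMap.sub_apply, Module.End.mul_apply, hv i j h, map_zero, sub_zero, if_true,
        hw] at this
      rw [Module.End.mul_apply, this]
      simp [h, h.ne, sub_smul]
    · subst h
      simp [hw, smul_smul, pow_two]
    · rw [Module.End.mul_apply, hv j i h]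
      simp [h.not_gt, h.ne']
  rw [← nsq_add_stair K μ, cas]
  simp only [LinearMap.add_apply, LinearMap.sum_apply, LinearMap.smul_apply, h1, hw,
    Module.End.one_apply, ← Finset.sum_smul, smul_smul, ← add_smul]
  congr 1
  simp [Finset.sum_add_distrib]

/-- A finite-dimensional representation of `gl_d` with a basis of weight vectors, the weights
being in `ℕ ^ d`. -/
structure WRep (K : Type*) [Field K] (d : ℕ) (ι : Type*) [Fintype ι] [DecidableEq ι] where
  wt : ι → Fin d →₀ ℕ
  E : Fin d → Fin d → Matrix ι ι K
  diag : ∀ i, E i i = Matrix.diagonal fun x => (wt x i : K)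
  shift : ∀ i j x y, E i j x y ≠ 0 → wt x + Finsupp.single j 1 = wt y + Finsupp.single i 1
  rel : GlRel E

variable {K : Type*} [Field K] {d : ℕ} {ι : Type*} [Fintype ι] [DecidableEq ι]

/-- The character of an endomorphism. -/
def WRep.ch (R : WRep K d ι) : Matrix ι ι K →ₗ[K] MvPolynomial (Fin d) K where
  toFun Z := ∑ x, monomial (R.wt x) (Z x x)
  map_add' _ _ := by simp [Finset.sum_add_distrib]
  map_smul' _ _ := by simp [Finset.smul_sum, smul_monomial]

lemma WRep.ch_apply (R : WRep K d ι) (Z : Matrix ι ι K) :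
    R.ch Z = ∑ x, monomial (R.wt x) (Z x x) := rfl

lemma WRep.eul_ch (R : WRep K d ι) (i : Fin d) (Z : Matrix ι ι K) :
    eul K i (R.ch Z) = R.ch (R.E i i * Z) := by
  simp [WRep.ch_apply, eul_monomial, R.diag]

lemma WRep.X_mul_ch (R : WRep K d ι) (i j : Fin d) (Z : Matrix ι ι K) :
    X j * R.ch (R.E i j * Z) = X i * R.ch (Z * R.E i j) := by
  simp only [WRep.ch_apply, Matrix.mul_apply, map_sum, Finset.mul_sum, X, monomial_mul, one_mul]
  rw [Finset.sum_comm]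
  refine Finset.sum_congr rfl fun y _ => Finset.sum_congr rfl fun x _ => ?_
  by_cases h : R.E i j x y = 0
  · simp [h]
  · rw [mul_comm, add_comm, R.shift i j x y h, add_comm]

/-- Multiplication of the character by the Vandermonde alternant turns the Casimir element into
the Laplacian. -/
lemma WRep.coeff_cas (R : WRep K d ι) (Z : Matrix ι ι K) (hZ : ∀ i j, Commute (R.E i j) Z)
    (n : Fin d →₀ ℕ) :
    coeff n (alt K (stair d) * R.ch (cas K R.E * Z)) =
      nsq n * coeff n (alt K (stair d) * R.ch Z) := by
  rw [← coeff_sum_eul_eul, sum_eul_eul_alt_mul (R.ch Z) (fun i j => R.ch (R.E i j * R.E j i * Z))]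
  · congr 2
    simp only [cas, add_mul, Finset.sum_mul, smul_mul_assoc, one_mul, map_add, map_sum, map_smul,
      R.eul_ch]
  · intro i j _
    have h1 := R.X_mul_ch i j (R.E j i * Z)
    rw [mul_assoc, ← (hZ i j).eq, ← mul_assoc, ← mul_assoc] at h1
    have h2 := congrArg (fun f => X i * R.ch (f * Z)) (R.rel i j j i)
    simp only [sub_mul, map_sub, if_true] at h2
    rw [sub_mul, h1, R.eul_ch, R.eul_ch, ← h2]
    ring
  · intro i
    rw [R.eul_ch, R.eul_ch, mul_assoc]

lemma WRep.commute_aeval (R : WRep K d ι) (p : Polynomial K) (i j : Fin d) :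
    Commute (R.E i j) (Polynomial.aeval (cas K R.E) p) := by
  refine Polynomial.induction_on (motive := fun p => Commute (R.E i j) (Polynomial.aeval (cas K R.E) p)) p ?_ ?_ ?_
  · intro a; rw [Polynomial.aeval_C]; exact Algebra.commute_algebraMap_right a _
  · intro p q hp hq; rw [map_add]; exact hp.add_right hq
  · intro n a _
    rw [map_mul, Polynomial.aeval_C, map_pow, Polynomial.aeval_X]
    exact (Algebra.commute_algebraMap_right a _).mul_right ((commute_cas R.rel i j).pow_right _)

lemma WRep.coeff_aeval_cas (R : WRep K d ι) (p : Polynomial K) (Z : Matrix ι ι K)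
    (hZ : ∀ i j, Commute (R.E i j) Z) (n : Fin d →₀ ℕ) :
    coeff n (alt K (stair d) * R.ch (Polynomial.aeval (cas K R.E) p * Z)) =
      p.eval (nsq n : K) * coeff n (alt K (stair d) * R.ch Z) := by
  induction p using Polynomial.induction_on' with
  | add p q hp hq => rw [map_add, add_mul, map_add, mul_add, coeff_add, hp, hq, Polynomial.eval_add,
      add_mul]
  | monomial m a =>
    rw [← Polynomial.C_mul_X_pow_eq_monomial]
    simp only [map_mul, Polynomial.aeval_C, map_pow, Polynomial.aeval_X, Polynomial.eval_mul,
      Polynomial.eval_C, Polynomial.eval_pow, Polynomial.eval_X]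
    rw [mul_assoc, ← Algebra.smul_def, map_smul, mul_smul_comm, coeff_smul, smul_eq_mul, mul_assoc]
    congr 1
    induction m with
    | zero => simp
    | succ m ih =>
      have hc : ∀ i j, Commute (R.E i j) (cas K R.E ^ m * Z) := fun i j =>
        ((commute_cas R.rel i j).pow_right _).mul_right (hZ i j)
      rw [pow_succ', mul_assoc, R.coeff_cas _ hc, ih]; ring

end SchubertAlg

namespace SchubertAlg

open MvPolynomial Matrix

/-- Spectral projectors onto generalised eigenspaces, as polynomials. -/
lemma exists_spectral_poly {K : Type*} [Field K] {ι : Type*} [Fintype ι] [DecidableEq ι]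
    (C : Matrix ι ι K) (c : K) :
    ∃ (p : Polynomial K) (m : ℕ), IsIdempotentElem (Polynomial.aeval C p) ∧ p.eval c = 1 ∧
      (C - c • 1) ^ m * Polynomial.aeval C p = 0 := by
  set q : Polynomial K := (Polynomial.X - Polynomial.C c) * C.charpoly with hq
  have hq0 : q ≠ 0 := mul_ne_zero (Polynomial.X_sub_C_ne_zero c) C.charpoly_monic.ne_zero
  have haq : Polynomial.aeval C q = 0 := by rw [hq, map_mul, Matrix.aeval_self_charpoly, mul_zero]
  obtain ⟨g, hg, hgc⟩ := Polynomial.exists_eq_pow_rootMultiplicity_mul_and_not_dvd q hq0 c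
  set m := q.rootMultiplicity c with hm
  have hm0 : m ≠ 0 := by
    rw [hm, ← Nat.pos_iff_ne_zero, Polynomial.rootMultiplicity_pos hq0, Polynomial.IsRoot, hq]
    simp
  have hcop : IsCoprime ((Polynomial.X - Polynomial.C c) ^ m) g :=
    IsCoprime.pow_left ((Polynomial.irreducible_X_sub_C c).coprime_iff_not_dvd.2 hgc)
  obtain ⟨u, v, huv⟩ := hcop
  have key : ∀ w : Polynomial K, Polynomial.aeval C (w * q) = 0 := fun w => by
    rw [map_mul, haq, mul_zero]
  refine ⟨v * g, m, ?_, ?_, ?_⟩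
  · have : v * g * (v * g) = v * g - (u * v) * q := by
      rw [hg]
      linear_combination (v * g) * huv
    rw [IsIdempotentElem, ← map_mul, this, map_sub, key, sub_zero]
  · have := congrArg (Polynomial.eval c) huv
    simpa [hm0] using this
  · have : (C - c • 1) ^ m = Polynomial.aeval C ((Polynomial.X - Polynomial.C c) ^ m) := by
      simp [Algebra.algebraMap_eq_smul_one]
    rw [this, ← map_mul]
    have : (Polynomial.X - Polynomial.C c) ^ m * (v * g) = v * q := by rw [hg]; ring
    rw [this, key]

lemma GlRel.map {A B : Type*} [Ring A] [Ring B] {d : ℕ} {E : Fin d → Fin d → A} (hE : GlRel E)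
    (f : A →+* B) : GlRel fun i j => f (E i j) := by
  intro i j k l
  have := congrArg f (hE i j k l)
  simpa [apply_ite f] using this

lemma map_cas {K A B : Type*} [Field K] [Ring A] [Ring B] [Algebra K A] [Algebra K B] {d : ℕ}
    (E : Fin d → Fin d → A) (f : A →ₐ[K] B) : f (cas K E) = cas K fun i j => f (E i j) := by
  simp [cas]

variable {K : Type*} [Field K] {d : ℕ} {ι : Type*} [Fintype ι] [DecidableEq ι]

/-- The shell of the character at the value `c` of the Casimir element. -/
lemma WRep.exists_shell [CharZero K] (R : WRep K d ι) (c : ℕ) :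
    ∃ p : Polynomial K, IsIdempotentElem (Polynomial.aeval (cas K R.E) p) ∧ p.eval (c : K) = 1 ∧
      (∃ m, (cas K R.E - (c : K) • 1) ^ m * Polynomial.aeval (cas K R.E) p = 0) ∧
      ∀ Z : Matrix ι ι K, (∀ i j, Commute (R.E i j) Z) → ∀ n : Fin d →₀ ℕ,
        coeff n (alt K (stair d) * R.ch (Polynomial.aeval (cas K R.E) p * Z)) =
          if nsq n = c then coeff n (alt K (stair d) * R.ch Z) else 0 := by
  obtain ⟨p, m, h1, h2, h3⟩ := exists_spectral_poly (cas K R.E) (c : K)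
  refine ⟨p, h1, h2, ⟨m, h3⟩, fun Z hZ n => ?_⟩
  split_ifs with h
  · rw [R.coeff_aeval_cas p Z hZ, h, h2, one_mul]
  · have h4 := R.coeff_aeval_cas ((Polynomial.X - Polynomial.C (c : K)) ^ m * p) Z hZ n
    have : Polynomial.aeval (cas K R.E) ((Polynomial.X - Polynomial.C (c : K)) ^ m * p) = 0 := by
      rw [← h3, map_mul, map_pow, map_sub, Polynomial.aeval_X, Polynomial.aeval_C,
        Algebra.algebraMap_eq_smul_one]
    rw [this, zero_mul, map_zero, mul_zero, coeff_zero] at h4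
    rw [R.coeff_aeval_cas p Z hZ]
    simp only [Polynomial.eval_mul, Polynomial.eval_pow, Polynomial.eval_sub, Polynomial.eval_X,
      Polynomial.eval_C, mul_assoc] at h4
    refine (mul_eq_zero.1 h4.symm).resolve_left (pow_ne_zero _ ?_)
    rw [sub_ne_zero]
    exact_mod_cast h

/-- A vector is of weight `μ`. -/
def WRep.HasWt (R : WRep K d ι) (μ : Fin d →₀ ℕ) (v : ι → K) : Prop := ∀ x, v x ≠ 0 → R.wt x = μ

lemma WRep.HasWt.diag {R : WRep K d ι} {μ : Fin d →₀ ℕ} {v : ι → K} (h : R.HasWt μ v) (i : Fin d) :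
    R.E i i *ᵥ v = (μ i : K) • v := by
  ext x
  rw [R.diag, mulVec_diagonal, Pi.smul_apply, smul_eq_mul]
  by_cases hx : v x = 0
  · simp [hx]
  · rw [h x hx]

lemma WRep.HasWt.shift {R : WRep K d ι} {μ : Fin d →₀ ℕ} {v : ι → K} (h : R.HasWt μ v)
    (i j : Fin d) {x : ι} (hx : (R.E i j *ᵥ v) x ≠ 0) :
    R.wt x + Finsupp.single j 1 = μ + Finsupp.single i 1 := by
  obtain ⟨y, _, hy⟩ := Finset.exists_ne_zero_of_sum_ne_zero hx
  rw [R.shift i j x y (left_ne_zero_of_mul hy), h y (right_ne_zero_of_mul hy)]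

lemma WRep.HasWt.exists_shift {R : WRep K d ι} {μ : Fin d →₀ ℕ} {v : ι → K} (h : R.HasWt μ v)
    (i j : Fin d) (h0 : R.E i j *ᵥ v ≠ 0) :
    ∃ ν, R.HasWt ν (R.E i j *ᵥ v) ∧ ν + Finsupp.single j 1 = μ + Finsupp.single i 1 ∧
      ∃ x, R.wt x = ν := by
  obtain ⟨x, hx⟩ := Function.ne_iff.1 h0
  refine ⟨R.wt x, fun y hy => ?_, h.shift i j hx, x, rfl⟩
  have := (h.shift i j hy).trans (h.shift i j hx).symm
  exact add_right_cancel this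

lemma WRep.wt_eq_of_commute [CharZero K] {R : WRep K d ι} {Z : Matrix ι ι K} (hZ : ∀ i, Commute (R.E i i) Z)
    {x y : ι} (h : Z x y ≠ 0) : R.wt x = R.wt y := by
  ext i
  have := congrFun (congrFun (hZ i).eq x) y
  rw [R.diag, diagonal_mul, mul_diagonal, mul_comm] at this
  exact_mod_cast mul_left_cancel₀ h this

/-- The pairing of exponent vectors. -/
def pair {d : ℕ} (m n : Fin d → ℕ) : ℕ := ∑ i, m i * n i

lemma pair_shift {d : ℕ} {ν μ : Fin d →₀ ℕ} {i j : Fin d} (n : Fin d → ℕ)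
    (h : ν + Finsupp.single j 1 = μ + Finsupp.single i 1) : pair ν n + n j = pair μ n + n i := by
  have e : ∀ (a : Fin d →₀ ℕ) (l : Fin d), pair (a + Finsupp.single l 1 : Fin d →₀ ℕ) n = pair a n + n l := by
    intro a l
    simp only [pair, Finsupp.add_apply, add_mul, Finset.sum_add_distrib, Finsupp.single_apply]
    simp
  rw [← e, ← e, h]

/-- An extremal argument: among the weights with a property stable under the raising operators
unless a vector dies, there is one killed by all of these. -/
lemma WRep.exists_highest (R : WRep K d ι) (n : Fin d → ℕ) (hn : StrictAnti n)
    (Q : (ι → K) → Prop) (hQ0 : ∀ v, Q v → v ≠ 0)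
    {ν : Fin d →₀ ℕ} {u : ι → K} (hu : R.HasWt ν u) (hQ : Q u) :
    ∃ μ v, R.HasWt μ v ∧ Q v ∧ pair ν n ≤ pair μ n ∧ ∀ i j, i < j → ¬ Q (R.E i j *ᵥ v) := by
  classical
  let T : Finset (Fin d →₀ ℕ) := (Finset.univ.image R.wt).filter
    fun μ => (∃ v, R.HasWt μ v ∧ Q v) ∧ pair ν n ≤ pair μ n
  have hmem : ∀ μ v, R.HasWt μ v → Q v → ∃ x, R.wt x = μ := by
    intro μ v h hq
    obtain ⟨x, hx⟩ := Function.ne_iff.1 (hQ0 v hq)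
    exact ⟨x, h x hx⟩
  have hT : T.Nonempty := by
    refine ⟨ν, ?_⟩
    obtain ⟨x, hx⟩ := hmem ν u hu hQ
    simp only [T, Finset.mem_filter, Finset.mem_image, Finset.mem_univ, true_and]
    exact ⟨⟨x, hx⟩, ⟨u, hu, hQ⟩, le_rfl⟩
  obtain ⟨μ, hμ, hmax⟩ := T.exists_max_image (fun μ => pair μ n) hT
  simp only [T, Finset.mem_filter, Finset.mem_image, Finset.mem_univ, true_and] at hμ hmax
  obtain ⟨_, ⟨v, hv, hQv⟩, hle⟩ := hμ
  refine ⟨μ, v, hv, hQv, hle, fun i j hij hc => ?_⟩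
  obtain ⟨ν', hν', hs, hx⟩ := hv.exists_shift i j (hQ0 _ hc)
  have h1 := pair_shift n hs
  have h2 := hn hij
  have h3 := hmax ν' ⟨hx, ⟨_, hν', hc⟩, by omega⟩
  omega

lemma WRep.cas_mulVec (R : WRep K d ι) {μ : Fin d →₀ ℕ} {v : ι → K} (h : R.HasWt μ v)
    (hv : ∀ i j, i < j → R.E i j *ᵥ v = 0) :
    cas K R.E *ᵥ v = (nsq (fun i => μ i + stair d i) : K) • v := by
  have h1 := cas_hw (R.rel.map (Matrix.toLinAlgEquiv' (R := K) (n := ι)).toRingEquiv.toRingHom)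
    μ v (fun i => h.diag i) hv
  rw [← h1]
  have := map_cas (K := K) R.E (Matrix.toLinAlgEquiv' (R := K) (n := ι)).toAlgHom
  exact congrArg (fun f : Module.End K (ι → K) => f v) this

lemma WRep.exists_pair_le [CharZero K] (R : WRep K d ι) {P : Matrix ι ι K} (hP : ∀ i j, Commute (R.E i j) P)
    {c m : ℕ} (hPc : (cas K R.E - (c : K) • 1) ^ m * P = 0) {n : Fin d → ℕ} (hn : StrictAnti n)
    {ν : Fin d →₀ ℕ} {u : ι → K} (hu : R.HasWt ν u) (hu0 : u ≠ 0) (hPu : P *ᵥ u = u) :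
    ∃ μ : Fin d → ℕ, pair ν n ≤ pair μ n ∧ nsq (fun i => μ i + stair d i) = c := by
  obtain ⟨μ, v, hv, ⟨hv0, hPv⟩, hle, hhw⟩ := R.exists_highest n hn (fun v => v ≠ 0 ∧ P *ᵥ v = v)
    (fun v h => h.1) hu ⟨hu0, hPu⟩
  refine ⟨μ, hle, ?_⟩
  have hkill : ∀ i j, i < j → R.E i j *ᵥ v = 0 := by
    intro i j hij
    by_contra hc
    exact hhw i j hij ⟨hc, by rw [mulVec_mulVec, ← (hP i j).eq, ← mulVec_mulVec, hPv]⟩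
  have hcas := R.cas_mulVec hv hkill
  set e : ℕ := nsq fun i => μ i + stair d i
  have hpow : ∀ m : ℕ, ((cas K R.E - (c : K) • 1) ^ m) *ᵥ v = ((e : K) - c) ^ m • v := by
    intro m
    induction m with
    | zero => simp
    | succ m ih =>
      rw [pow_succ, ← mulVec_mulVec, sub_mulVec, hcas, smul_mulVec, one_mulVec, ← sub_smul,
        mulVec_smul, ih, smul_smul, pow_succ']
  have h0 := hpow m
  nth_rw 1 [← hPv] at h0
  rw [mulVec_mulVec, hPc, zero_mulVec, eq_comm, smul_eq_zero] at h0
  have h1 := eq_zero_of_pow_eq_zero (h0.resolve_right hv0)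
  exact_mod_cast sub_eq_zero.1 h1

end SchubertAlg

namespace SchubertAlg

open MvPolynomial Matrix

lemma strictAnti_stair (d : ℕ) : StrictAnti (stair d) := by
  intro a b h
  have := b.2
  rw [Fin.lt_def] at h
  simp only [stair]
  omega

lemma pair_stair_comp_lt {d : ℕ} {n : Fin d → ℕ} (hn : StrictAnti n) {σ : Equiv.Perm (Fin d)}
    (hσ : σ ≠ 1) : pair (stair d ∘ σ) n < pair (stair d) n := by
  have hm : Monovary (stair d) n := fun i j h =>
    (strictAnti_stair d).antitone (hn.lt_iff_gt.1 h).le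
  refine hm.sum_comp_perm_mul_lt_sum_mul_iff.2 fun h => hσ ?_
  have hmono : Monotone σ := by
    intro i j hij
    rcases hij.eq_or_lt with rfl | hij
    · exact le_rfl
    · exact (strictAnti_stair d).le_iff_ge.1 (h (hn hij))
  have hs := hmono.strictMono_of_injective σ.injective
  have := (hs.range_inj strictMono_id).1 (by simp [σ.surjective.range_eq])
  ext i
  simp [this]

lemma pair_le_of_nsq_eq {d : ℕ} {a n : Fin d → ℕ} (h : nsq a = nsq n) : pair a n ≤ nsq n := by
  have h1 : 2 * pair a n ≤ nsq a + nsq n := by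
    rw [pair, nsq, nsq, Finset.mul_sum, ← Finset.sum_add_distrib]
    refine Finset.sum_le_sum fun i _ => ?_
    zify
    nlinarith [sq_nonneg ((a i : ℤ) - n i)]
  omega

/-- The weights of a highest weight vector are dominant. -/
lemma antitone_of_highest {K : Type*} [Field K] [CharZero K] {d : ℕ} {W : Type*} [AddCommGroup W]
    [Module K W] {D : Fin d → Fin d → Module.End K W} (hD : GlRel D) {μ : Fin d → ℕ} {w : W}
    (hw0 : w ≠ 0) (hw : ∀ i, D i i w = (μ i : K) • w) (hw' : ∀ i j, i < j → D i j w = 0)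
    (hnil : ∀ i j, i < j → ∃ m, (D j i ^ m) w = 0) : Antitone μ := by
  intro i j hij
  rcases hij.eq_or_lt with rfl | hij
  · exact le_rfl
  by_contra! hlt
  have hrel : ∀ a b k l u, D a b (D k l u) = D k l (D a b u) +
      ((if b = k then D a l else 0) u - (if l = a then D k b else 0) u) := by
    intro a b k l u
    have := congrArg (fun f : Module.End K W => f u) (hD a b k l)
    simp only [LinearMap.sub_apply, Module.End.mul_apply] at this
    rw [← this]; abel
  have hi : ∀ m : ℕ, D i i ((D j i ^ m) w) = ((μ i : K) - m) • (D j i ^ m) w := by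
    intro m
    induction m with
    | zero => simp [hw]
    | succ m ih =>
      rw [pow_succ', Module.End.mul_apply, hrel, ih]
      simp only [hij.ne, if_true, if_false, map_smul, LinearMap.zero_apply, zero_sub]
      push_cast
      module
  have hj : ∀ m : ℕ, D j j ((D j i ^ m) w) = ((μ j : K) + m) • (D j i ^ m) w := by
    intro m
    induction m with
    | zero => simp [hw]
    | succ m ih =>
      rw [pow_succ', Module.End.mul_apply, hrel, ih]
      simp only [hij.ne, if_true, if_false, map_smul, LinearMap.zero_apply, sub_zero]
      push_cast
      module
  have he : ∀ m : ℕ, D i j ((D j i ^ (m + 1)) w) =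
      (((m : K) + 1) * ((μ i : K) - μ j - m)) • (D j i ^ m) w := by
    intro m
    induction m with
    | zero =>
      rw [zero_add, pow_one, hrel, hw' i j hij]
      simp only [if_true, map_zero, pow_zero, Module.End.one_apply, hw]
      push_cast
      module
    | succ m ih =>
      rw [pow_succ', Module.End.mul_apply, hrel, ih]
      simp only [if_true, map_smul, hi, hj]
      rw [pow_succ' (D j i) m, Module.End.mul_apply]
      push_cast
      module
  obtain ⟨m, hm⟩ := hnil i j hij
  induction m with
  | zero => exact hw0 (by simpa using hm)
  | succ m ih =>
    have h := he m
    rw [hm, map_zero, eq_comm, smul_eq_zero] at h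
    refine ih (h.resolve_left (mul_ne_zero (by exact_mod_cast m.succ_ne_zero) ?_))
    intro h0
    have : (μ i : K) = ((μ j + m : ℕ) : K) := by push_cast; linear_combination h0
    have := Nat.cast_injective this
    omega

variable {K : Type*} [Field K] {d : ℕ} {ι : Type*} [Fintype ι] [DecidableEq ι]
  {W : Type*} [AddCommGroup W] [Module K W]

/-- The component of weight `μ` of a vector. -/
def WRep.comp (R : WRep K d ι) (μ : Fin d →₀ ℕ) : Matrix ι ι K :=
  diagonal fun x => if R.wt x = μ then 1 else 0

lemma WRep.comp_mulVec (R : WRep K d ι) (μ : Fin d →₀ ℕ) (v : ι → K) (x : ι) :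
    (R.comp μ *ᵥ v) x = if R.wt x = μ then v x else 0 := by
  simp [WRep.comp, mulVec_diagonal]

lemma WRep.commute_comp [CharZero K] (R : WRep K d ι) (μ : Fin d →₀ ℕ) {Z : Matrix ι ι K}
    (hZ : ∀ i, Commute (R.E i i) Z) : Commute (R.comp μ) Z := by
  ext x y
  rw [WRep.comp, diagonal_mul, mul_diagonal]
  by_cases h : Z x y = 0
  · simp [h]
  · rw [R.wt_eq_of_commute hZ h, mul_comm]

lemma WRep.sum_comp (R : WRep K d ι) (v : ι → K) :
    ∑ μ ∈ Finset.univ.image R.wt, R.comp μ *ᵥ v = v := by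
  ext x
  rw [Finset.sum_apply]
  simp only [R.comp_mulVec]
  rw [Finset.sum_ite_eq, if_pos (Finset.mem_image_of_mem _ (Finset.mem_univ _))]

lemma WRep.aeval_cas_intertwine (R : WRep K d ι) {D : Fin d → Fin d → Module.End K W}
    {φ : (ι → K) →ₗ[K] W} (hφ : ∀ i j v, φ (R.E i j *ᵥ v) = D i j (φ v)) (p : Polynomial K)
    (v : ι → K) :
    φ (Polynomial.aeval (cas K R.E) p *ᵥ v) = Polynomial.aeval (cas K D) p (φ v) := by
  have h1 : ∀ v, φ (cas K R.E *ᵥ v) = cas K D (φ v) := by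
    intro v
    simp [cas, add_mulVec, Matrix.sum_mulVec, smul_mulVec, hφ, ← mulVec_mulVec]
  induction p using Polynomial.induction_on' with
  | add p q hp hq => simp [add_mulVec, hp, hq]
  | monomial m a =>
    rw [← Polynomial.C_mul_X_pow_eq_monomial]
    simp only [map_mul, Polynomial.aeval_C, map_pow, Polynomial.aeval_X,
      Algebra.algebraMap_eq_smul_one, smul_mul_assoc, one_mul, smul_mulVec, map_smul,
      LinearMap.smul_apply]
    congr 1
    induction m with
    | zero => simp
    | succ m ih => rw [pow_succ', ← mulVec_mulVec, h1, ih, pow_succ', Module.End.mul_apply]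

lemma commute_aeval_cas {E : Fin d → Fin d → Matrix ι ι K} {Z : Matrix ι ι K}
    (hZ : ∀ i j, Commute (E i j) Z) (p : Polynomial K) :
    Commute (Polynomial.aeval (cas K E) p) Z := by
  refine Polynomial.induction_on (motive := fun p =>
    Commute (Polynomial.aeval (cas K E) p) Z) p ?_ ?_ ?_
  · intro a; rw [Polynomial.aeval_C]; exact Algebra.commute_algebraMap_left a _
  · intro p q hp hq; rw [map_add]; exact hp.add_left hq
  · intro m a _
    rw [map_mul, Polynomial.aeval_C, map_pow, Polynomial.aeval_X]
    refine (Algebra.commute_algebraMap_left a _).mul_left (Commute.pow_left ?_ _)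
    refine ((Commute.sum_left _ _ _ fun i _ => Commute.sum_left _ _ _ fun j _ =>
      (hZ i j).mul_left (hZ j i)).add_left ((Commute.sum_left _ _ _ fun i _ =>
        hZ i i).smul_left _)).add_left ((Commute.one_left _).smul_left _)

lemma aeval_apply_of_eq_smul {f : Module.End K W} {c : K} {w : W} (h : f w = c • w)
    (p : Polynomial K) : Polynomial.aeval f p w = p.eval c • w := by
  by_cases hw : w = 0
  · simp [hw]
  · exact Module.End.aeval_apply_of_hasEigenvector
      ⟨Module.End.mem_eigenspace_iff.2 h, hw⟩

lemma WRep.coeff_ch (R : WRep K d ι) (Z : Matrix ι ι K) (μ : Fin d →₀ ℕ) :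
    coeff μ (R.ch Z) = (R.comp μ * Z).trace := by
  rw [R.ch_apply, coeff_sum, Matrix.trace]
  refine Finset.sum_congr rfl fun x _ => ?_
  rw [coeff_monomial, diag_apply, WRep.comp, diagonal_mul]
  simp

lemma trace_ne_zero_of_idempotent [CharZero K] {T : Matrix ι ι K} (hT : IsIdempotentElem T)
    (h0 : T ≠ 0) : T.trace ≠ 0 := by
  intro h
  have hi : IsIdempotentElem (Matrix.toLin' T) := by
    rw [IsIdempotentElem, Module.End.mul_eq_comp, ← Matrix.toLin'_mul, hT.eq]
  have := LinearMap.IsIdempotentElem.trace_eq_zero_iff hi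
  rw [Matrix.trace_toLin'_eq, h] at this
  exact h0 ((Matrix.toLin' (R := K)).injective ((this.1 rfl).trans (map_zero _).symm))

lemma WRep.pow_lower_mulVec {R : WRep K d ι} {μ : Fin d →₀ ℕ} {v : ι → K} (h : R.HasWt μ v)
    {i j : Fin d} (hij : i ≠ j) (m : ℕ) :
    ∀ x, ((R.E j i ^ m) *ᵥ v) x ≠ 0 → R.wt x i + m = μ i := by
  induction m with
  | zero => intro x hx; rw [h x (by simpa using hx)]; rfl
  | succ m ih =>
    intro x hx
    rw [pow_succ', ← mulVec_mulVec] at hx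
    obtain ⟨y, _, hy⟩ := Finset.exists_ne_zero_of_sum_ne_zero hx
    have h1 := ih y (right_ne_zero_of_mul hy)
    have h2 := congrArg (fun f => f i) (R.shift j i x y (left_ne_zero_of_mul hy))
    simp [hij.symm] at h2
    omega

/-- If the image of an idempotent endomorphism has a vector surviving in `W`, then its character
has a highest weight which occurs in `W`. -/
lemma WRep.exists_coeff_ne_zero [CharZero K] (R : WRep K d ι) {Z : Matrix ι ι K}
    (hZi : IsIdempotentElem Z) (hZ : ∀ i j, Commute (R.E i j) Z)
    {D : Fin d → Fin d → Module.End K W} (hD : GlRel D) {φ : (ι → K) →ₗ[K] W}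
    (hφ : ∀ i j v, φ (R.E i j *ᵥ v) = D i j (φ v)) {r : ι → K} (hr : Z *ᵥ r = r) (h0 : φ r ≠ 0)
    {q : ℕ} (hq : ∀ x, φ (Pi.single x 1) ≠ 0 → ∀ i, R.wt x i ≤ q) :
    ∃ n, coeff n (alt K (stair d) * R.ch Z) ≠ 0 ∧ ∀ i, n i ≤ q + (d - 1) := by
  obtain ⟨ν, hν⟩ : ∃ ν, φ (R.comp ν *ᵥ r) ≠ 0 := by
    by_contra! h
    apply h0
    rw [← R.sum_comp r, map_sum]
    exact Finset.sum_eq_zero fun μ _ => h μ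
  have hwt : R.HasWt ν (R.comp ν *ᵥ r) := by
    intro x hx
    rw [R.comp_mulVec] at hx
    exact (ite_ne_right_iff.1 hx).1
  have hZν : Z *ᵥ (R.comp ν *ᵥ r) = R.comp ν *ᵥ r := by
    rw [mulVec_mulVec, ← (R.commute_comp ν fun i => hZ i i).eq, ← mulVec_mulVec, hr]
  obtain ⟨μ, v, hv, ⟨hZv, hφv⟩, -, hkill⟩ := R.exists_highest (stair d) (strictAnti_stair d)
    (fun v => Z *ᵥ v = v ∧ φ v ≠ 0) (fun v h hv0 => h.2 (by rw [hv0, map_zero])) hwt ⟨hZν, hν⟩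
  have hw : ∀ i, D i i (φ v) = (μ i : K) • φ v := fun i => by rw [← hφ, hv.diag, map_smul]
  have hw' : ∀ i j, i < j → D i j (φ v) = 0 := by
    intro i j hij
    by_contra hc
    refine hkill i j hij ⟨?_, by rwa [hφ]⟩
    rw [mulVec_mulVec, ← (hZ i j).eq, ← mulVec_mulVec, hZv]
  have hφp : ∀ i j (m : ℕ) u, φ ((R.E i j ^ m) *ᵥ u) = (D i j ^ m) (φ u) := by
    intro i j m u
    induction m with
    | zero => simp
    | succ m ih => rw [pow_succ', ← mulVec_mulVec, hφ, ih, pow_succ', Module.End.mul_apply]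
  have hanti : Antitone μ := by
    refine antitone_of_highest hD hφv hw hw' fun i j hij => ⟨μ i + 1, ?_⟩
    rw [← hφp]
    have : (R.E j i ^ (μ i + 1)) *ᵥ v = 0 := by
      ext x
      by_contra hx
      have := WRep.pow_lower_mulVec hv hij.ne _ x hx
      omega
    rw [this, map_zero]
  set n : Fin d →₀ ℕ := μ + Finsupp.equivFunOnFinite.symm (stair d) with hn
  have hnf : ∀ i, n i = μ i + stair d i := fun i => rfl
  have hna : StrictAnti n := fun i j hij =>
    add_lt_add_of_le_of_lt (hanti hij.le) (strictAnti_stair d hij)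
  obtain ⟨p, hp1, hp2, ⟨m, hp3⟩, hp4⟩ := R.exists_shell (nsq n)
  set P := Polynomial.aeval (cas K R.E) p
  have hPc : ∀ i j, Commute (R.E i j) P := R.commute_aeval p
  have hPZ : Commute P Z := commute_aeval_cas hZ p
  have hPv : φ (P *ᵥ v) ≠ 0 := by
    rw [R.aeval_cas_intertwine hφ, aeval_apply_of_eq_smul (cas_hw hD μ _ hw hw')]
    have : p.eval (nsq (fun i => μ i + stair d i) : K) = 1 := hp2
    rw [this, one_smul]
    exact hφv
  have hYi : IsIdempotentElem (P * Z) := hp1.mul_of_commute hPZ hZi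
  have hYc : ∀ i j, Commute (R.E i j) (P * Z) := fun i j => (hPc i j).mul_right (hZ i j)
  refine ⟨n, ?_, fun i => ?_⟩
  · have h5 := hp4 Z hZ n
    rw [if_pos rfl] at h5
    rw [← h5, alt_eq_sum, Finset.sum_mul, coeff_sum, Finset.sum_eq_single 1]
    · rw [coeff_monomial_mul', if_pos (by intro i; simp [hn])]
      have : n - Finsupp.equivFunOnFinite.symm (stair d ∘ (1 : Equiv.Perm (Fin d))) = μ := by
        ext i; simp [hn]
      rw [this, R.coeff_ch]
      simp only [Equiv.Perm.sign_one, Units.val_one, Int.cast_one, one_mul]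
      have hcm := R.commute_comp μ fun i => hYc i i
      have hci : IsIdempotentElem (R.comp μ) := by
        rw [IsIdempotentElem, WRep.comp, diagonal_mul_diagonal]
        congr 1; ext x; split_ifs <;> simp
      refine trace_ne_zero_of_idempotent (hci.mul_of_commute hcm hYi) fun h => hPv ?_
      have h6 : (R.comp μ * (P * Z)) *ᵥ v = P *ᵥ v := by
        rw [hcm.eq, ← mulVec_mulVec]
        have : R.comp μ *ᵥ v = v := by
          ext x
          rw [R.comp_mulVec]
          by_cases hx : v x = 0
          · simp [hx]
          · rw [if_pos (hv x hx)]
        rw [this, ← mulVec_mulVec, hZv]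
      rw [← h6, h, zero_mulVec, map_zero]
    · intro σ _ hσ
      rw [coeff_monomial_mul']
      split_ifs with hle
      swap
      · rfl
      rw [R.ch_apply, coeff_sum]
      refine mul_eq_zero_of_right _ (Finset.sum_eq_zero fun x _ => ?_)
      rw [coeff_monomial]
      split_ifs with hx
      swap
      · rfl
      by_contra hne
      set u : ι → K := (P * Z) *ᵥ Pi.single x 1 with hu
      have hux : ∀ y, u y = (P * Z) y x := fun y => by simp [hu]
      have huw : R.HasWt (R.wt x) u := fun y hy =>
        R.wt_eq_of_commute (fun i => hYc i i) (by rwa [hux] at hy)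
      have hu0 : u ≠ 0 := fun h => hne (by rw [← hux, h]; rfl)
      have hPu : P *ᵥ u = u := by rw [hu, mulVec_mulVec, ← mul_assoc, hp1.eq]
      obtain ⟨μ', h7, h8⟩ := R.exists_pair_le hPc hp3 hna huw hu0 hPu
      have h9 := pair_le_of_nsq_eq h8
      have h10 := pair_stair_comp_lt hna hσ
      have e1 : nsq n = pair (R.wt x) n + pair (stair d ∘ σ) n := by
        rw [hx, nsq, pair, pair, ← Finset.sum_add_distrib]
        refine Finset.sum_congr rfl fun i _ => ?_
        rw [← add_mul, pow_two]
        congr 1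
        have := hle i
        simp at this ⊢
        omega
      have e2 : pair (fun i => μ' i + stair d i) n = pair μ' n + pair (stair d) n := by
        simp [pair, add_mul, Finset.sum_add_distrib]
      omega
    · simp
  · obtain ⟨x, hx⟩ : ∃ x, φ (v x • Pi.single x 1) ≠ 0 := by
      by_contra! h
      apply hφv
      rw [pi_eq_sum_univ' v, map_sum]
      refine Finset.sum_eq_zero fun x _ => ?_
      convert h x using 3
    rw [map_smul] at hx
    have h1 := hq x (right_ne_zero_of_smul hx) i
    rw [hv x (left_ne_zero_of_smul hx)] at h1
    rw [hnf, stair]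
    omega

end SchubertAlg

namespace SchubertAlg

section derivation

variable {K M : Type*} [Field K] [AddCommGroup M] [Module K M]

/-- The algebra map `w ↦ w + ε D w` attached to an endomorphism of the space of generators. -/
def extLift (f : Module.End K M) :
    ExteriorAlgebra K M →ₐ[K] TrivSqZeroExt (ExteriorAlgebra K M) (ExteriorAlgebra K M) :=
  ExteriorAlgebra.lift K
    ⟨(TrivSqZeroExt.inlAlgHom K _ _).toLinearMap ∘ₗ ExteriorAlgebra.ι K +
      (TrivSqZeroExt.inrHom _ _).restrictScalars K ∘ₗ ExteriorAlgebra.ι K ∘ₗ f, fun m => by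
      ext
      · simp
      · simp [ExteriorAlgebra.ι_add_mul_swap]⟩

lemma fst_extLift (f : Module.End K M) (w : ExteriorAlgebra K M) : (extLift f w).fst = w := by
  have : (TrivSqZeroExt.fstHom K _ _).comp (extLift f) = AlgHom.id K _ := by
    apply ExteriorAlgebra.hom_ext
    ext m
    simp [extLift]
  exact congrArg (fun g : ExteriorAlgebra K M →ₐ[K] ExteriorAlgebra K M => g w) this

/-- The derivation of the exterior algebra extending an endomorphism. -/
def extDer (f : Module.End K M) : Module.End K (ExteriorAlgebra K M) :=
  (TrivSqZeroExt.sndHom _ _).restrictScalars K ∘ₗ (extLift f).toLinearMap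

lemma extDer_ι (f : Module.End K M) (m : M) :
    extDer f (ExteriorAlgebra.ι K m) = ExteriorAlgebra.ι K (f m) := by
  simp [extDer, extLift]

lemma extDer_mul (f : Module.End K M) (a b : ExteriorAlgebra K M) :
    extDer f (a * b) = a * extDer f b + extDer f a * b := by
  simp [extDer, fst_extLift]

lemma extDer_algebraMap (f : Module.End K M) (c : K) :
    extDer f (algebraMap K (ExteriorAlgebra K M) c) = 0 := by
  simp [extDer, TrivSqZeroExt.algebraMap_eq_inl']

lemma extDer_one (f : Module.End K M) : extDer f 1 = 0 := by
  simpa using extDer_algebraMap f 1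

/-- The derivations of the exterior algebra depend linearly on the endomorphism. -/
def extDerHom : Module.End K M →ₗ[K] Module.End K (ExteriorAlgebra K M) where
  toFun := extDer
  map_add' f g := by
    refine LinearMap.ext fun w => ?_
    induction w using ExteriorAlgebra.induction with
    | algebraMap r => simp [extDer_algebraMap]
    | ι m => simp [extDer_ι]
    | mul a b ha hb =>
      simp only [LinearMap.add_apply, extDer_mul] at ha hb ⊢
      rw [ha, hb]; noncomm_ring
    | add a b ha hb => simp only [map_add, ha, hb]
  map_smul' c f := by
    refine LinearMap.ext fun w => ?_
    induction w using ExteriorAlgebra.induction with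
    | algebraMap r => simp [extDer_algebraMap]
    | ι m => simp [extDer_ι]
    | mul a b ha hb =>
      simp only [LinearMap.smul_apply, extDer_mul, RingHom.id_apply] at ha hb ⊢
      rw [ha, hb]; simp
    | add a b ha hb => simp only [map_add, ha, hb]

lemma extDer_comm (f g : Module.End K M) :
    extDer f * extDer g - extDer g * extDer f = extDer (f * g - g * f) := by
  refine LinearMap.ext fun w => ?_
  simp only [LinearMap.sub_apply, Module.End.mul_apply]
  induction w using ExteriorAlgebra.induction with
  | algebraMap r => simp [extDer_algebraMap]
  | ι m => simp [extDer_ι]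
  | mul a b ha hb =>
    simp only [extDer_mul, map_add, ← ha, ← hb]
    noncomm_ring
  | add a b ha hb => simp only [map_add, ← ha, ← hb]; abel

lemma extDer_ιMulti (f : Module.End K M) (n : ℕ) (v : Fin n → M) :
    extDer f (ExteriorAlgebra.ιMulti K n v) =
      ∑ i, ExteriorAlgebra.ιMulti K n (Function.update v i (f (v i))) := by
  induction n with
  | zero => simp [extDer_one]
  | succ n ih =>
    rw [ExteriorAlgebra.ιMulti_succ_apply, extDer_mul, ih, Fin.sum_univ_succ, extDer_ι, add_comm,
      Finset.mul_sum]
    simp only [ExteriorAlgebra.ιMulti_succ_apply]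
    have h1 : Matrix.vecTail (Function.update v 0 (f (v 0))) = Matrix.vecTail v := by
      ext i; simp [Matrix.vecTail]
    have h2 : ∀ x : Fin n, Matrix.vecTail (Function.update v x.succ (f (v x.succ))) =
        Function.update (Matrix.vecTail v) x (f (Matrix.vecTail v x)) := by
      intro x
      exact Function.update_comp_eq_of_injective v (Fin.succ_injective n) x _
    simp only [h1, h2, Function.update_self, Function.update_of_ne (Fin.succ_ne_zero _).symm]
lemma extDer_ιMulti_of_eigen (f : Module.End K M) {n : ℕ} {v : Fin n → M} {c : Fin n → K}
    (h : ∀ i, f (v i) = c i • v i) :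
    extDer f (ExteriorAlgebra.ιMulti K n v) = (∑ i, c i) • ExteriorAlgebra.ιMulti K n v := by
  rw [extDer_ιMulti, Finset.sum_smul]
  refine Finset.sum_congr rfl fun i _ => ?_
  rw [h, AlternatingMap.map_update_smul, Function.update_eq_self]

lemma extDer_ιMulti_eq_zero (f : Module.End K M) {n : ℕ} {v : Fin n → M}
    (h : ∀ i, f (v i) = 0 ∨ ∃ j, j ≠ i ∧ f (v i) = v j) :
    extDer f (ExteriorAlgebra.ιMulti K n v) = 0 := by
  rw [extDer_ιMulti]
  refine Finset.sum_eq_zero fun i _ => ?_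
  rcases h i with h | ⟨j, hj, h⟩
  · rw [h]; exact AlternatingMap.map_update_zero _ _ _
  · exact AlternatingMap.map_eq_zero_of_eq _ _ (i := i) (j := j) (by simp [hj, h]) hj.symm

lemma ιMulti_ne_zero {n : ℕ} {v : Fin n → M} (hv : LinearIndependent K v) :
    ExteriorAlgebra.ιMulti K n v ≠ 0 := by
  have h := (exteriorPower.ιMulti_family_linearIndependent_field n hv).ne_zero
    ⟨Finset.univ, by simp [Set.powersetCard]⟩
  intro h0
  apply h
  ext
  rw [exteriorPower.ιMulti_family_apply_coe, ExteriorAlgebra.ιMulti_family]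
  set e := Set.powersetCard.ofFinEmbEquiv.symm (⟨Finset.univ, by simp [Set.powersetCard]⟩ : Set.powersetCard (Fin n) n)
  have := AlternatingMap.map_perm (ExteriorAlgebra.ιMulti K n) v
    (Equiv.ofBijective e (Finite.injective_iff_bijective.1 e.injective))
  rw [h0, smul_zero] at this
  exact this


end derivation

end SchubertAlg

namespace SchubertAlg

open MvPolynomial Matrix

section operators

variable {K : Type*} [Field K] {d : ℕ} {B : Type*} [Fintype B]

/-- The action of `gl_d` on the exterior algebra of the space of `d × B` matrices. -/
def glOp (B : Type*) [Fintype B] : Matrix (Fin d) (Fin d) K →ₗ[K]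
    Module.End K (ExteriorAlgebra K (Matrix (Fin d) B K)) :=
  extDerHom ∘ₗ LinearMap.mk₂ K (fun (X : Matrix (Fin d) (Fin d) K) (m : Matrix (Fin d) B K) => X * m)
    Matrix.add_mul (fun c X m => Matrix.smul_mul c X m) Matrix.mul_add
    (fun c X m => Matrix.mul_smul X c m)

lemma glOp_apply (X : Matrix (Fin d) (Fin d) K) : glOp B X =
    extDer (LinearMap.mk₂ K (fun (X : Matrix (Fin d) (Fin d) K) (m : Matrix (Fin d) B K) => X * m)
    Matrix.add_mul (fun c X m => Matrix.smul_mul c X m) Matrix.mul_add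
    (fun c X m => Matrix.mul_smul X c m) X) := rfl

lemma glOp_ι (X : Matrix (Fin d) (Fin d) K) (m : Matrix (Fin d) B K) :
    glOp B X (ExteriorAlgebra.ι K m) = ExteriorAlgebra.ι K (X * m) :=
  extDer_ι _ _

lemma glOp_mul (X : Matrix (Fin d) (Fin d) K) (a b : ExteriorAlgebra K (Matrix (Fin d) B K)) :
    glOp B X (a * b) = a * glOp B X b + glOp B X a * b :=
  extDer_mul _ _ _

lemma glOp_comm (X Y : Matrix (Fin d) (Fin d) K) :
    glOp B X * glOp B Y - glOp B Y * glOp B X = glOp B (X * Y - Y * X) := by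
  rw [glOp_apply, glOp_apply, extDer_comm, glOp_apply]
  congr 1
  ext m : 1
  simp [Matrix.mul_assoc]

lemma glRel_glOp {G : Fin d → Fin d → Matrix (Fin d) (Fin d) K}
    (hG : ∀ i j k l, G i j * G k l = if j = k then G i l else 0) :
    GlRel fun i j => glOp B (G i j) := by
  intro i j k l
  rw [glOp_comm, hG, hG, map_sub, apply_ite (glOp B), apply_ite (glOp B), map_zero]

/-- The matrix units with respect to a frame. -/
def frameUnit (g : Matrix (Fin d) (Fin d) K) (i j : Fin d) : Matrix (Fin d) (Fin d) K :=
  vecMulVec (fun a => g a i) (g⁻¹ j)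

lemma frameUnit_mulVec {g : Matrix (Fin d) (Fin d) K} (hg : IsUnit g.det) (i j k : Fin d) :
    frameUnit g i j *ᵥ (fun a => g a k) = if j = k then fun a => g a i else 0 := by
  rw [frameUnit, vecMulVec_mulVec]
  have : g⁻¹ j ⬝ᵥ (fun a => g a k) = (g⁻¹ * g) j k := rfl
  rw [this, nonsing_inv_mul g hg, one_apply]
  split_ifs <;> simp

lemma frameUnit_mul {g : Matrix (Fin d) (Fin d) K} (hg : IsUnit g.det) (i j k l : Fin d) :
    frameUnit g i j * frameUnit g k l = if j = k then frameUnit g i l else 0 := by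
  rw [frameUnit, frameUnit, vecMulVec_mul_vecMulVec]
  have : g⁻¹ j ⬝ᵥ (fun a => g a k) = (g⁻¹ * g) j k := rfl
  rw [this, nonsing_inv_mul g hg, one_apply]
  split_ifs <;> simp [frameUnit]

/-- The Casimir element does not depend on the frame. -/
lemma cas_frameUnit {g : Matrix (Fin d) (Fin d) K} (hg : IsUnit g.det) :
    cas K (fun i j => glOp B (frameUnit g i j)) = cas K (fun i j => glOp B (single i j 1)) := by
  have hs : ∀ i j, frameUnit g i j = ∑ a, ∑ b, (g a i * g⁻¹ j b) • single a b 1 := by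
    intro i j
    rw [matrix_eq_sum_single (frameUnit g i j)]
    simp [frameUnit, vecMulVec_apply, smul_single]
  have hgg : ∀ a b, ∑ i, g a i * g⁻¹ i b = if a = b then 1 else 0 := by
    intro a b
    rw [← Matrix.mul_apply, mul_nonsing_inv g hg, one_apply]
  have h1 : ∑ i, frameUnit g i i = ∑ i, single i i (1 : K) := by
    simp only [hs]
    rw [Finset.sum_comm]
    refine Finset.sum_congr rfl fun a _ => ?_
    rw [Finset.sum_comm]
    simp only [← Finset.sum_smul, hgg]
    simp
  have hs' : ∀ x : Fin d × Fin d, glOp B (frameUnit g x.1 x.2) = ∑ p : Fin d × Fin d,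
      (g p.1 x.1 * g⁻¹ x.2 p.2) • glOp B (single p.1 p.2 (1 : K)) := by
    intro x
    rw [hs, Fintype.sum_prod_type]
    simp only [map_sum, map_smul]
  have h2 : ∑ x : Fin d × Fin d, glOp B (frameUnit g x.1 x.2) * glOp B (frameUnit g x.2 x.1) =
      ∑ x : Fin d × Fin d, glOp B (single x.1 x.2 (1 : K)) * glOp B (single x.2 x.1 1) := by
    have e : ∀ x : Fin d × Fin d, glOp B (frameUnit g x.1 x.2) * glOp B (frameUnit g x.2 x.1) =
        ∑ p : Fin d × Fin d, ∑ p' : Fin d × Fin d,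
          ((g p.1 x.1 * g⁻¹ x.1 p'.2) * (g p'.1 x.2 * g⁻¹ x.2 p.2)) •
          (glOp B (single p.1 p.2 (1 : K)) * glOp B (single p'.1 p'.2 1)) := by
      intro x
      rw [hs' x, hs' (x.2, x.1), Finset.sum_mul_sum]
      refine Finset.sum_congr rfl fun p _ => Finset.sum_congr rfl fun p' _ => ?_
      rw [smul_mul_smul_comm]
      congr 1
      ring
    simp only [e]
    rw [Finset.sum_comm]
    refine Finset.sum_congr rfl fun p _ => ?_
    rw [Finset.sum_comm, Finset.sum_eq_single (p.2, p.1)]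
    · rw [← Finset.sum_smul, Fintype.sum_prod_type]
      simp only [← Finset.mul_sum, hgg, if_true, mul_one, one_smul]
    · rintro ⟨u, v⟩ _ hne
      rw [← Finset.sum_smul, Fintype.sum_prod_type]
      simp only [← Finset.mul_sum, hgg, ← Finset.sum_mul]
      have : ¬ (p.1 = v ∧ u = p.2) := fun h => hne (by rw [h.1, h.2])
      by_cases h1 : p.1 = v
      · have h2 : u ≠ p.2 := fun h => this ⟨h1, h⟩
        simp [h2]
      · simp [h1]
    · simp
  simp only [Fintype.sum_prod_type] at h2
  simp only [cas, h2, ← map_sum, h1]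

lemma glOp_diag_bound [CharZero K] (i : Fin d) {w : ExteriorAlgebra K (Matrix (Fin d) B K)} {c : ℕ}
    (h : glOp B (single i i 1) w = (c : K) • w) (hc : Fintype.card B < c) : w = 0 := by
  classical
  set q := Fintype.card B
  set p : Polynomial K := ∏ e ∈ Finset.range (q + 1), (Polynomial.X - Polynomial.C (e : K))
  have hp : ∀ e : ℕ, e ≤ q → p.eval (e : K) = 0 := by
    intro e he
    rw [Polynomial.eval_prod]
    exact Finset.prod_eq_zero (Finset.mem_range.2 (Nat.lt_succ_of_le he)) (by simp)
  have hpc : p.eval (c : K) ≠ 0 := by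
    rw [Polynomial.eval_prod, Finset.prod_ne_zero_iff]
    intro e he
    rw [Finset.mem_range] at he
    simp only [Polynomial.eval_sub, Polynomial.eval_X, Polynomial.eval_C, sub_ne_zero]
    exact_mod_cast (by omega : c ≠ e)
  set T := Polynomial.aeval (glOp B (single i i (1 : K))) p with hT
  suffices hT0 : T = 0 by
    have := aeval_apply_of_eq_smul h p
    rw [← hT, hT0, LinearMap.zero_apply, eq_comm, smul_eq_zero] at this
    exact this.resolve_left hpc
  have hA : ∀ n, T.compAlternatingMap (ExteriorAlgebra.ιMulti K (M := Matrix (Fin d) B K) n) = 0 := by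
    intro n
    refine Module.Basis.ext_alternating (Matrix.stdBasis K (Fin d) B) fun v hv => ?_
    have h1 : glOp B (single i i (1 : K)) (ExteriorAlgebra.ιMulti K n
        fun a => Matrix.stdBasis K (Fin d) B (v a)) =
        ((Finset.univ.filter fun a => (v a).1 = i).card : K) • ExteriorAlgebra.ιMulti K n
        fun a => Matrix.stdBasis K (Fin d) B (v a) := by
      rw [glOp_apply, extDer_ιMulti_of_eigen _ (c := fun a => if (v a).1 = i then 1 else 0)]
      · simp
      · intro a
        rw [Matrix.stdBasis_eq_single]
        split_ifs with hi
        · simp [hi]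
        · simp [single_mul_single_of_ne _ _ _ _ (Ne.symm hi)]
    have h2 := aeval_apply_of_eq_smul h1 p
    rw [hp, zero_smul] at h2
    · exact h2
    · have : Set.InjOn (fun a => (v a).2) (Finset.univ.filter fun a => (v a).1 = i) := by
        intro a ha b hb hab
        simp only [Finset.coe_filter, Finset.mem_univ, true_and, Set.mem_ofPred_eq] at ha hb
        exact hv (Prod.ext (ha.trans hb.symm) hab)
      rw [← Finset.card_image_of_injOn this]
      exact Finset.card_le_univ _
  refine LinearMap.ext_on_range (ExteriorAlgebra.ιMulti_span K (Matrix (Fin d) B K)) fun x => ?_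
  exact congrArg (fun f => f x.2) (hA x.1)

end operators

end SchubertAlg

namespace SchubertAlg

open MvPolynomial Matrix Kronecker

section models

variable {K : Type*} [Field K] {d : ℕ} {W : Type*} [Ring W] [Algebra K W]

/-- A vector `w` lies in the image of a representation of `gl_d` with character `f`, the
representation being given as the image of an idempotent. -/
def Model (D : Fin d → Fin d → Module.End K W) (f : MvPolynomial (Fin d) K) (w : W) : Prop :=
  ∃ (ι : Type) (_ : Fintype ι) (_ : DecidableEq ι) (R : WRep K d ι) (Z : Matrix ι ι K)
    (a : ι → W) (r : ι → K), IsIdempotentElem Z ∧ (∀ i j, Commute (R.E i j) Z) ∧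
    (∀ i j x, D i j (a x) = ∑ y, R.E i j y x • a y) ∧ Z *ᵥ r = r ∧ ∑ x, r x • a x = w ∧ R.ch Z = f

lemma Model.one {D : Fin d → Fin d → Module.End K W} (hD : ∀ i j, D i j 1 = 0) :
    Model D 1 1 := by
  refine ⟨Unit, inferInstance, inferInstance, ⟨fun _ => 0, fun _ _ => 0, ?_, ?_, ?_⟩, 1,
    fun _ => 1, fun _ => 1, ?_, ?_, ?_, ?_, ?_, ?_⟩
  · intro i; ext; simp
  · intro i j x y h; exact absurd rfl h
  · intro i j k l; simp
  · exact IsIdempotentElem.one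
  · intro i j; exact Commute.one_right _
  · intro i j x; simp [hD]
  · simp
  · simp
  · simp [WRep.ch_apply]

lemma Model.mul {D : Fin d → Fin d → Module.End K W}
    (hD : ∀ i j a b, D i j (a * b) = a * D i j b + D i j a * b)
    {f g : MvPolynomial (Fin d) K} {v w : W} (hv : Model D f v) (hw : Model D g w) :
    Model D (f * g) (v * w) := by
  obtain ⟨ι, _, _, R, Z, a, r, hZ, hc, ha, hr, rfl, rfl⟩ := hv
  obtain ⟨κ, _, _, S, Y, b, s, hY, he, hb, hs, rfl, rfl⟩ := hw
  refine ⟨ι × κ, inferInstance, inferInstance, ⟨fun x => R.wt x.1 + S.wt x.2,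
    fun i j => R.E i j ⊗ₖ 1 + 1 ⊗ₖ S.E i j, ?_, ?_, ?_⟩, Z ⊗ₖ Y,
    fun x => a x.1 * b x.2, fun x => r x.1 * s x.2, ?_, ?_, ?_, ?_, ?_, ?_⟩
  · intro i
    rw [R.diag, S.diag, ← diagonal_one, ← diagonal_one, diagonal_kronecker_diagonal,
      diagonal_kronecker_diagonal, diagonal_add]
    simp
  · rintro i j ⟨x, x'⟩ ⟨y, y'⟩ h
    simp only [Matrix.add_apply, kroneckerMap_apply] at h
    by_cases h1 : R.E i j x y * (1 : Matrix κ κ K) x' y' = 0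
    · rw [h1, zero_add] at h
      have h2 := S.shift i j x' y' (right_ne_zero_of_mul h)
      have h3 : x = y := by
        by_contra hne
        exact left_ne_zero_of_mul h (one_apply_ne hne)
      subst h3
      rw [add_assoc, h2, add_assoc]
    · have h2 := R.shift i j x y (left_ne_zero_of_mul h1)
      have h3 : x' = y' := by
        by_contra hne
        exact right_ne_zero_of_mul h1 (one_apply_ne hne)
      subst h3
      rw [add_right_comm, h2, add_right_comm]
  · intro i j k l
    have h1 := congrArg (fun A => A ⊗ₖ (1 : Matrix κ κ K)) (R.rel i j k l)
    have h2 := congrArg (fun A => (1 : Matrix ι ι K) ⊗ₖ A) (S.rel i j k l)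
    have s1 : ∀ A A' : Matrix ι ι K, (A - A') ⊗ₖ (1 : Matrix κ κ K) = A ⊗ₖ 1 - A' ⊗ₖ 1 := by
      intro A A'; ext; simp [sub_mul]
    have s2 : ∀ A A' : Matrix κ κ K, (1 : Matrix ι ι K) ⊗ₖ (A - A') = 1 ⊗ₖ A - 1 ⊗ₖ A' := by
      intro A A'; ext; simp [mul_sub]
    simp only [s1, s2] at h1 h2
    have e : ∀ (A A' : Matrix ι ι K) (C C' : Matrix κ κ K),
        (A ⊗ₖ (1 : Matrix κ κ K) + (1 : Matrix ι ι K) ⊗ₖ C) * (A' ⊗ₖ 1 + 1 ⊗ₖ C') =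
        (A * A') ⊗ₖ 1 + A ⊗ₖ C' + A' ⊗ₖ C + 1 ⊗ₖ (C * C') := by
      intro A A' C C'
      simp only [add_mul, mul_add, ← mul_kronecker_mul, one_mul, mul_one]
      abel
    rw [e, e]
    have h3 := congrArg₂ (· + ·) h1 h2
    rw [show ∀ a b c e f g : Matrix (ι × κ) (ι × κ) K, a + b + c + e - (f + c + b + g) =
      (a - f) + (e - g) by intros; abel]
    refine h3.trans ?_
    split_ifs <;> simp <;> abel
  · rw [IsIdempotentElem, ← mul_kronecker_mul, hZ.eq, hY.eq]
  · intro i j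
    rw [commute_iff_eq]
    simp only [add_mul, mul_add, ← mul_kronecker_mul, one_mul, mul_one, (hc i j).eq, (he i j).eq]
  · rintro i j ⟨x, y⟩
    rw [hD, ha, hb, Fintype.sum_prod_type]
    simp only [Matrix.add_apply, kroneckerMap_apply, add_smul, Finset.sum_add_distrib, one_apply]
    rw [add_comm]
    congr 1
    · rw [Finset.sum_mul]
      refine Finset.sum_congr rfl fun x' _ => ?_
      simp
    · rw [Finset.mul_sum, Finset.sum_comm]
      refine Finset.sum_congr rfl fun x' _ => ?_
      simp
  · ext ⟨x, y⟩
    have h1 := congrFun hr x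
    have h2 := congrFun hs y
    simp only [mulVec, dotProduct, kroneckerMap_apply, Fintype.sum_prod_type] at h1 h2 ⊢
    rw [← h1, ← h2, Finset.sum_mul_sum]
    exact Finset.sum_congr rfl fun _ _ => Finset.sum_congr rfl fun _ _ => by ring
  · rw [Fintype.sum_prod_type, Finset.sum_mul_sum]
    exact Finset.sum_congr rfl fun _ _ => Finset.sum_congr rfl fun _ _ =>
      (smul_mul_smul_comm _ _ _ _).symm
  · simp only [WRep.ch_apply, Fintype.sum_prod_type, Finset.sum_mul_sum, monomial_mul,
      kroneckerMap_apply]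

/-- The standard representation. -/
lemma Model.vec {D : Fin d → Fin d → Module.End K W} (a : Fin d → W)
    (ha : ∀ i j x, D i j (a x) = if j = x then a i else 0) (r : Fin d → K) :
    Model D (∑ i, X i) (∑ x, r x • a x) := by
  refine ⟨Fin d, inferInstance, inferInstance, ⟨fun x => Finsupp.single x 1,
    fun i j => single i j 1, ?_, ?_, ?_⟩, 1, a, r, ?_, ?_, ?_, ?_, rfl, ?_⟩
  · intro i
    ext x y
    simp only [single_apply, diagonal_apply, Finsupp.single_apply]
    by_cases h : x = y
    · subst h; by_cases h1 : i = x <;> simp [h1, eq_comm]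
    · simp [h]; rintro rfl; exact h
  · intro i j x y h
    simp only [single_apply, ne_eq, ite_eq_right_iff, one_ne_zero, imp_false, not_not] at h
    obtain ⟨rfl, rfl⟩ := h
    exact add_comm _ _
  · intro i j k l
    split_ifs with h1 h2 h2
    all_goals simp [*]
  · exact IsIdempotentElem.one
  · intro i j; exact Commute.one_right _
  · intro i j x
    rw [ha]
    simp [single_apply, ite_and]
  · simp
  · simp [WRep.ch_apply, X]

end models

end SchubertAlg

namespace SchubertAlg

open MvPolynomial Matrix

section shell

variable {K : Type*} [Field K] {d : ℕ} {W : Type*} [Ring W] [Algebra K W]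

/-- An eigenvector of the Casimir element lies in the corresponding part of a model. -/
lemma Model.shell [CharZero K] {D : Fin d → Fin d → Module.End K W} {f : MvPolynomial (Fin d) K}
    {w : W} (h : Model D f w) {c : ℕ} (hc : cas K D w = (c : K) • w) :
    ∃ f', Model D f' w ∧ ∀ n, coeff n (alt K (stair d) * f') =
      if nsq n = c then coeff n (alt K (stair d) * f) else 0 := by
  obtain ⟨ι, _, _, R, Z, a, r, hZ, hcm, ha, hr, rfl, rfl⟩ := h
  obtain ⟨p, hp1, hp2, -, hp4⟩ := R.exists_shell c
  set P := Polynomial.aeval (cas K R.E) p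
  have hPZ : Commute P Z := commute_aeval_cas hcm p
  have hφ : ∀ i j v, Fintype.linearCombination K a (R.E i j *ᵥ v) =
      D i j (Fintype.linearCombination K a v) := by
    intro i j v
    simp only [Fintype.linearCombination_apply, map_sum, map_smul, ha, mulVec, dotProduct,
      Finset.sum_smul, Finset.smul_sum, smul_smul]
    rw [Finset.sum_comm]
    exact Finset.sum_congr rfl fun _ _ => Finset.sum_congr rfl fun _ _ => by rw [mul_comm]
  refine ⟨_, ⟨ι, inferInstance, inferInstance, R, P * Z, a, P *ᵥ r,
    hp1.mul_of_commute hPZ hZ, fun i j => (R.commute_aeval p i j).mul_right (hcm i j), ha, ?_, ?_,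
    rfl⟩, hp4 Z hcm⟩
  · rw [mulVec_mulVec, mul_assoc, ← hPZ.eq, ← mul_assoc, hp1.eq, ← mulVec_mulVec, hr]
  · have h1 := R.aeval_cas_intertwine hφ p r
    rw [Fintype.linearCombination_apply, Fintype.linearCombination_apply,
      aeval_apply_of_eq_smul hc, hp2, one_smul] at h1
    exact h1

lemma alt_mul_sum_X (n : Fin d → ℕ) :
    alt K n * ∑ i, X i = ∑ i, alt K (n + Pi.single i 1) := by
  simp only [alt_eq_sum, Finset.sum_mul_sum]
  refine Eq.trans (Finset.sum_congr rfl fun σ _ => ?_) Finset.sum_comm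
  refine Eq.trans ?_ (Equiv.sum_comp σ _)
  refine Finset.sum_congr rfl fun i _ => ?_
  rw [X, monomial_mul, mul_one]
  refine congrArg (fun e => monomial e _) (Finsupp.ext fun j => ?_)
  by_cases h : i = j <;> simp [h, eq_comm]

lemma nsq_add_single (n : Fin d → ℕ) (i : Fin d) :
    nsq (n + Pi.single i 1) = nsq n + 2 * n i + 1 := by
  simp only [nsq, Pi.add_apply, Pi.single_apply]
  rw [Finset.sum_congr rfl fun j _ => show (n j + if j = i then 1 else 0) ^ 2 =
    n j ^ 2 + if j = i then 2 * n j + 1 else 0 by split_ifs <;> ring]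
  simp [Finset.sum_add_distrib, add_assoc]

end shell

section block

variable {K : Type*} [Field K] {d : ℕ} {B : Type*} [Fintype B] {U : Type*}

/-- The number of boxes in a row. -/
def rowCount {n : ℕ} (v : Fin n → Fin d × U) (t : Fin d) : ℕ :=
  ∑ a, if (v a).1 = t then 1 else 0

/-- A sequence of boxes such that the boxes above a given one come later. -/
def IsStacked {n : ℕ} (v : Fin n → Fin d × U) : Prop :=
  Function.Injective v ∧ ∀ a k, k < (v a).1 → ∃ b, a < b ∧ v b = (k, (v a).2)

lemma IsStacked.antitone {n : ℕ} {v : Fin n → Fin d × U} (hv : IsStacked v) :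
    Antitone (rowCount v) := by
  intro k l hkl
  rcases hkl.eq_or_lt with rfl | hkl
  · rfl
  simp only [rowCount, ← Finset.card_filter]
  have h : ∀ a ∈ Finset.univ.filter (fun a => (v a).1 = l), ∃ b, v b = (k, (v a).2) := by
    intro a ha
    obtain ⟨b, -, hb⟩ := hv.2 a k (by rwa [(Finset.mem_filter.1 ha).2])
    exact ⟨b, hb⟩
  choose! f hf using h
  refine Finset.card_le_card_of_injOn f (fun a ha => ?_) fun a ha b hb hab => ?_
  · simp [hf a ha]
  · apply hv.1
    have h1 := hf a ha
    rw [hab, hf b hb] at h1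
    refine Prod.ext ?_ (Prod.ext_iff.1 h1).2.symm
    rw [(Finset.mem_filter.1 ha).2, (Finset.mem_filter.1 hb).2]

lemma IsStacked.tail {n : ℕ} {v : Fin (n + 1) → Fin d × U} (hv : IsStacked v) :
    IsStacked (fun a => v a.succ) := by
  refine ⟨fun a b h => Fin.succ_injective _ (hv.1 h), fun a k hk => ?_⟩
  obtain ⟨b, hb, h⟩ := hv.2 a.succ k hk
  have hb0 : b ≠ 0 := (lt_of_le_of_lt (Fin.zero_le _) hb).ne'
  refine ⟨b.pred hb0, ?_, ?_⟩
  · rw [← Fin.succ_lt_succ_iff, Fin.succ_pred]; exact hb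
  · exact (congrArg v (Fin.succ_pred b hb0)).trans h

/-- The exterior product of rank one matrices indexed by a stack of boxes. -/
def stackVec (g : Matrix (Fin d) (Fin d) K) (β : U → B → K) {n : ℕ} (v : Fin n → Fin d × U) :
    ExteriorAlgebra K (Matrix (Fin d) B K) :=
  ExteriorAlgebra.ιMulti K n fun a => vecMulVec (fun x => g x (v a).1) (β (v a).2)

lemma cas_stackVec {g : Matrix (Fin d) (Fin d) K} (hg : IsUnit g.det) (β : U → B → K) {n : ℕ}
    {v : Fin n → Fin d × U} (hv : IsStacked v) :
    cas K (fun i j => glOp B (single i j (1 : K))) (stackVec g β v) =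
      (nsq (rowCount v + stair d) : K) • stackVec g β v := by
  rw [← cas_frameUnit hg]
  have h : ∀ i j a, frameUnit g i j * vecMulVec (fun x => g x (v a).1) (β (v a).2) =
      if j = (v a).1 then vecMulVec (fun x => g x i) (β (v a).2) else 0 := by
    intro i j a
    rw [mul_vecMulVec, frameUnit_mulVec hg]
    split_ifs <;> simp
  refine cas_hw (glRel_glOp (frameUnit_mul hg)) (rowCount v) _ (fun i => ?_) fun i j hij => ?_
  · rw [stackVec, glOp_apply, extDer_ιMulti_of_eigen (c := fun a => if (v a).1 = i then 1 else 0)]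
    · simp [rowCount]
    · intro a
      refine (h i i a).trans ?_
      by_cases hi : i = (v a).1
      · simp [← hi]
      · simp [hi, Ne.symm hi]
  · rw [stackVec, glOp_apply]
    refine extDer_ιMulti_eq_zero _ fun a => ?_
    by_cases hj : j = (v a).1
    · right
      obtain ⟨b, hb, hvb⟩ := hv.2 a i (hj ▸ hij)
      refine ⟨b, hb.ne', (h i j a).trans ?_⟩
      rw [if_pos hj, hvb]
    · left
      exact (h i j a).trans (if_neg hj)

/-- The exterior product of a stack of boxes lies in an irreducible representation. -/
lemma exists_model_stackVec [CharZero K] {g : Matrix (Fin d) (Fin d) K} (hg : IsUnit g.det) (β : U → B → K)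
    (n : ℕ) (v : Fin n → Fin d × U) (hv : IsStacked v) :
    ∃ f, Model (fun i j => glOp B (single i j (1 : K))) f (stackVec g β v) ∧
      alt K (stair d) * f = alt K (rowCount v + stair d) := by
  induction n with
  | zero =>
    refine ⟨1, ?_, ?_⟩
    · rw [stackVec, ExteriorAlgebra.ιMulti_zero_apply]
      exact Model.one fun i j => by rw [glOp_apply, extDer_one]
    · rw [mul_one]
      congr 1
      ext t
      simp [rowCount]
  | succ n ih =>
    obtain ⟨f, hf, hf'⟩ := ih _ hv.tail
    set t := (v 0).1
    have hrow : rowCount v + stair d =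
        (rowCount (fun a => v a.succ) + stair d) + Pi.single t 1 := by
      ext i
      simp only [rowCount, Pi.add_apply, Fin.sum_univ_succ, Pi.single_apply, t, eq_comm (a := i)]
      ring
    have hvec := Model.vec (D := fun i j => glOp B (single i j (1 : K)))
      (fun x => ExteriorAlgebra.ι K (vecMulVec (Pi.single x 1) (β (v 0).2))) (fun i j x => by
        rw [glOp_ι, mul_vecMulVec]
        split_ifs with h
        · subst h; congr 2; ext k; simp [mulVec, single_apply, Pi.single_apply, eq_comm]
        · have : (single i j (1 : K)) *ᵥ Pi.single x 1 = 0 := by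
            ext k; simp [h]
          rw [this]; simp) (fun x => g x t)
    have hw : (∑ x, g x t • ExteriorAlgebra.ι K (vecMulVec (Pi.single x 1) (β (v 0).2))) *
        stackVec g β (fun a => v a.succ) = stackVec g β v := by
      rw [stackVec, stackVec, ExteriorAlgebra.ιMulti_succ_apply]
      congr 1
      simp only [← map_smul, ← map_sum]
      congr 1
      ext i j
      simp [Matrix.sum_apply, vecMulVec_apply, Pi.single_apply, t]
    have hm := hvec.mul (fun i j => glOp_mul _) hf
    rw [hw] at hm
    obtain ⟨f', hf1, hf2⟩ := hm.shell (cas_stackVec hg β hv)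
    refine ⟨f', hf1, ?_⟩
    have hinj : Function.Injective (rowCount (fun a => v a.succ) + stair d) :=
      StrictAnti.injective fun i j hij =>
        add_lt_add_of_le_of_lt (hv.tail.antitone hij.le) (strictAnti_stair d hij)
    ext m
    rw [hf2, mul_left_comm, hf', mul_comm, alt_mul_sum_X, coeff_sum, hrow]
    set μ := rowCount (fun a => v a.succ) + stair d
    split_ifs with h
    · refine Finset.sum_eq_single t (fun i _ hi => ?_) (by simp)
      by_contra hne
      obtain ⟨σ, hσ⟩ := coeff_alt_ne_zero hne
      rw [hσ, nsq_comp_perm, nsq_add_single, nsq_add_single] at h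
      exact hi (hinj (by omega))
    · by_contra hne
      obtain ⟨σ, hσ⟩ := coeff_alt_ne_zero (Ne.symm hne)
      rw [hσ, nsq_comp_perm] at h
      exact h rfl

end block

end SchubertAlg

namespace SchubertAlg

open MvPolynomial Matrix

/-- The boxes of the partition attached to a subset `κ` of `Fin r`, the columns being indexed by
the complement of `κ`. -/
def boxes {d r : ℕ} (κ : Fin d → Fin r) : Finset (Fin d × Fin r) :=
  Finset.univ.filter fun p => (∀ t, κ t ≠ p.2) ∧ κ p.1 < p.2

lemma mem_boxes {d r : ℕ} {κ : Fin d → Fin r} {p : Fin d × Fin r} :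
    p ∈ boxes κ ↔ (∀ t, κ t ≠ p.2) ∧ κ p.1 < p.2 := by
  simp [boxes]

lemma card_row_boxes {d r : ℕ} {κ : Fin d → Fin r} (hκ : StrictMono κ) (t : Fin d) :
    ((boxes κ).filter fun p => p.1 = t).card + stair d t = r - 1 - κ t := by
  have h1 : (boxes κ).filter (fun p => p.1 = t) =
      (Finset.univ.filter fun u => (∀ t, κ t ≠ u) ∧ κ t < u).image (Prod.mk t) := by
    ext ⟨l, u⟩
    simp only [Finset.mem_filter, mem_boxes, Finset.mem_image, Finset.mem_univ, true_and,
      Prod.mk.injEq, exists_eq_right_right]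
    constructor
    · rintro ⟨h, rfl⟩; exact ⟨h, rfl⟩
    · rintro ⟨h, rfl⟩; exact ⟨h, rfl⟩
  have h2 : (Finset.Ioi (κ t)) =
      (Finset.univ.filter fun u => (∀ t, κ t ≠ u) ∧ κ t < u) ∪ (Finset.Ioi t).image κ := by
    ext u
    simp only [Finset.mem_Ioi, Finset.mem_union, Finset.mem_filter, Finset.mem_univ, true_and,
      Finset.mem_image]
    constructor
    · intro h
      by_cases h' : ∀ t, κ t ≠ u
      · exact Or.inl ⟨h', h⟩
      · push Not at h'
        obtain ⟨l, rfl⟩ := h'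
        exact Or.inr ⟨l, hκ.lt_iff_lt.1 h, rfl⟩
    · rintro (h | ⟨l, hl, rfl⟩)
      · exact h.2
      · exact hκ hl
  rw [h1, Finset.card_image_of_injective _ (Prod.mk_right_injective t), ← Fin.card_Ioi, h2,
    Finset.card_union_of_disjoint, Finset.card_image_of_injective _ hκ.injective, Fin.card_Ioi,
    stair]
  rw [Finset.disjoint_left]
  intro u hu hu'
  obtain ⟨l, -, rfl⟩ := Finset.mem_image.1 hu'
  exact (Finset.mem_filter.1 hu).2.1 l rfl

lemma exists_isStacked {d r : ℕ} {κ : Fin d → Fin r} (hκ : StrictMono κ) :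
    ∃ v : Fin (boxes κ).card → Fin d × Fin r, IsStacked v ∧ (∀ a, v a ∈ boxes κ) ∧
      rowCount v + stair d = fun t => r - 1 - κ t := by
  let e := ((boxes κ).map (toLex : Fin d × Fin r ≃ Fin d ×ₗ Fin r).toEmbedding).orderEmbOfFin
    (Finset.card_map _)
  let v : Fin (boxes κ).card → Fin d × Fin r := fun a => ofLex (e a.rev)
  have hv : Function.Injective v := fun a b h => Fin.rev_injective (e.injective (ofLex.injective h))
  have hm : ∀ a, v a ∈ boxes κ := by
    intro a
    have := Finset.orderEmbOfFin_mem _ (Finset.card_map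
      (toLex : Fin d × Fin r ≃ Fin d ×ₗ Fin r).toEmbedding (s := boxes κ)) a.rev
    obtain ⟨p, hp, h⟩ := Finset.mem_map.1 this
    have : v a = p := congrArg ofLex h.symm
    rwa [this]
  have hi : Finset.univ.image v = boxes κ :=
    Finset.eq_of_subset_of_card_le (fun p hp => by
      obtain ⟨a, -, rfl⟩ := Finset.mem_image.1 hp
      exact hm a) (by rw [Finset.card_image_of_injective _ hv, Finset.card_univ, Fintype.card_fin])
  refine ⟨v, ⟨hv, fun a k hk => ?_⟩, hm, ?_⟩
  · have h1 := mem_boxes.1 (hm a)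
    have h2 : (k, (v a).2) ∈ boxes κ := mem_boxes.2 ⟨h1.1, (hκ hk).trans h1.2⟩
    rw [← hi] at h2
    obtain ⟨b, -, hb⟩ := Finset.mem_image.1 h2
    refine ⟨b, ?_, hb⟩
    rw [← Fin.rev_lt_rev, ← e.lt_iff_lt]
    change toLex (v b) < toLex (v a)
    rw [hb, Prod.Lex.toLex_lt_toLex]
    exact Or.inl hk
  · ext t
    rw [← card_row_boxes hκ t, Pi.add_apply, rowCount, ← Finset.card_filter,
      ← congrArg (Finset.filter fun p => p.1 = t) hi, Finset.filter_image, Finset.card_image_of_injective _ hv]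

lemma eDimZ_eq {d r s : ℕ} (κ : Fin s → Fin d → Fin r) (hκ : ∀ j, StrictMono (κ j)) :
    eDimZ r d κ = d * (r - d) - ∑ j, ((boxes (κ j)).card : ℤ) := by
  rw [eDimZ]
  congr 1
  refine Finset.sum_congr rfl fun j _ => ?_
  rw [Finset.card_eq_sum_card_fiberwise (f := Prod.fst) (t := Finset.univ) (by simp)]
  push_cast
  refine Finset.sum_congr rfl fun t _ => ?_
  have h := card_row_boxes (hκ j) t
  rw [stair] at h
  have := (κ j t).2
  have := t.2
  omega

lemma map_alt {R S : Type*} [CommRing R] [CommRing S] (f : R →+* S) {d : ℕ} (n : Fin d → ℕ) :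
    map f (alt R n) = alt S n := by
  rw [alt, RingHom.map_det, alt]
  congr 1
  ext1 a i
  simp

lemma alt_stair_ne_zero (K : Type*) [Field K] (d : ℕ) : alt K (stair d) ≠ 0 := by
  rw [alt_stair, Finset.prod_ne_zero_iff]
  intro p hp
  rw [sub_ne_zero]
  exact fun h => (Finset.mem_filter.1 hp).2.ne (X_injective h)

section models

variable {K : Type*} [Field K] {d : ℕ} {W : Type*} [Ring W] [Algebra K W]

lemma Model.prod {D : Fin d → Fin d → Module.End K W}
    (hD : ∀ i j a b, D i j (a * b) = a * D i j b + D i j a * b) (hD1 : ∀ i j, D i j 1 = 0)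
    {s : ℕ} {f : Fin s → MvPolynomial (Fin d) K} {w : Fin s → W} (h : ∀ j, Model D (f j) (w j)) :
    Model D (∏ j, f j) (List.ofFn w).prod := by
  induction s with
  | zero => simpa using Model.one hD1
  | succ s ih =>
    rw [Fin.prod_univ_succ, List.ofFn_succ, List.prod_cons]
    exact (h 0).mul hD (ih fun j => h j.succ)

lemma Model.exists_coeff_ne_zero [CharZero K] {D : Fin d → Fin d → Module.End K W}
    {f : MvPolynomial (Fin d) K} {w : W} (h : Model D f w) (hD : GlRel D) (hw : w ≠ 0) {q : ℕ}
    (hq : ∀ (i : Fin d) (u : W) (c : ℕ), D i i u = (c : K) • u → q < c → u = 0) :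
    ∃ n, coeff n (alt K (stair d) * f) ≠ 0 ∧ ∀ i, n i ≤ q + (d - 1) := by
  obtain ⟨ι, _, _, R, Z, a, r, hZ, hcm, ha, hr, rfl, rfl⟩ := h
  refine R.exists_coeff_ne_zero hZ hcm hD (φ := Fintype.linearCombination K a) ?_ hr hw ?_
  · intro i j v
    simp only [Fintype.linearCombination_apply, map_sum, map_smul, ha, mulVec, dotProduct,
      Finset.sum_smul, Finset.smul_sum, smul_smul]
    rw [Finset.sum_comm]
    exact Finset.sum_congr rfl fun _ _ => Finset.sum_congr rfl fun _ _ => by rw [mul_comm]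
  · intro x hx i
    rw [Fintype.linearCombination_apply_single, one_smul] at hx
    by_contra! hlt
    refine hx (hq i _ _ ?_ hlt)
    rw [ha, R.diag]
    simp [diagonal_apply, ite_smul]

end models

lemma prod_stackVec_ne_zero {K : Type*} [Field K] {d s : ℕ} {B U : Type*} [Fintype B]
    (g : Fin s → Matrix (Fin d) (Fin d) K) (β : Fin s → U → B → K) {m : Fin s → ℕ}
    (v : ∀ j, Fin (m j) → Fin d × U) (hv : ∀ j, Function.Injective (v j))
    {A : Set (Fin s × Fin d × U)} (hA : ∀ j a, (j, v j a) ∈ A)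
    (h : LinearIndepOn K (fun x : Fin s × Fin d × U =>
      vecMulVec (fun a => g x.1 a x.2.1) (β x.1 x.2.2)) A) :
    (List.ofFn fun j => stackVec (g j) (β j) (v j)).prod ≠ 0 := by
  set e := fun x : Fin s × Fin d × U => vecMulVec (fun a => g x.1 a x.2.1) (β x.1 x.2.2)
  set L := (List.ofFn fun j => List.ofFn fun a => (j, v j a)).flatten with hL
  have hn : L.Nodup := by
    rw [hL, List.nodup_flatten]
    refine ⟨fun l hl => ?_, ?_⟩
    · obtain ⟨j, rfl⟩ := List.mem_ofFn.1 hl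
      exact List.nodup_ofFn.2 fun a b hab => hv j (Prod.ext_iff.1 hab).2
    · rw [List.pairwise_ofFn]
      intro i j hij x hx hx'
      obtain ⟨a, rfl⟩ := List.mem_ofFn.1 hx
      obtain ⟨b, hb⟩ := List.mem_ofFn.1 hx'
      exact hij.ne' (Prod.ext_iff.1 hb).1
  have hLA : ∀ i, L.get i ∈ A := by
    intro i
    obtain ⟨l, hl, hx⟩ := List.mem_flatten.1 (List.get_mem L i)
    obtain ⟨j, rfl⟩ := List.mem_ofFn.1 hl
    obtain ⟨a, ha⟩ := List.mem_ofFn.1 hx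
    rw [← ha]
    exact hA j a
  have h1 : (List.ofFn fun j => stackVec (g j) (β j) (v j)).prod =
      ExteriorAlgebra.ιMulti K L.length fun i => e (L.get i) := by
    have h2 : (List.ofFn fun i => ExteriorAlgebra.ι K (e (L.get i))) =
        L.map fun x => ExteriorAlgebra.ι K (e x) := by
      conv_rhs => rw [← List.ofFn_get L, List.map_ofFn]
      rfl
    rw [ExteriorAlgebra.ιMulti_apply, h2, hL, List.map_flatten, List.prod_flatten, List.map_map,
      List.map_ofFn]
    congr 2
    ext1 j
    simp only [Function.comp_apply, List.map_ofFn, stackVec, ExteriorAlgebra.ιMulti_apply]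
    rfl
  rw [h1]
  refine ιMulti_ne_zero ?_
  exact h.comp (fun i => (⟨L.get i, hLA i⟩ : A)) fun i j hij =>
    List.nodup_iff_injective_get.1 hn (Subtype.ext_iff.1 hij)

/-- The linear algebra condition for the tangent spaces of Schubert cells to intersect transversally
implies that the product of Schubert classes does not vanish. -/
theorem eDimZ_nonneg_and_prod_ne_zero {K : Type*} [Field K] [CharZero K] {d r s : ℕ} (hd0 : 0 < d)
    (hd : d ≤ r) (κ : Fin s → Fin d → Fin r) (hκ : ∀ j, StrictMono (κ j))
    {B : Type*} [Fintype B] (hB : Fintype.card B + d = r)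
    (g : Fin s → Matrix (Fin d) (Fin d) K) (hg : ∀ j, IsUnit (g j).det)
    (β : Fin s → Fin r → B → K)
    (h : LinearIndepOn K (fun x : Fin s × Fin d × Fin r =>
      vecMulVec (fun a => g x.1 a x.2.1) (β x.1 x.2.2)) {x | x.2 ∈ boxes (κ x.1)}) :
    0 ≤ eDimZ r d κ ∧ ∏ j, omegaCls (κ j) ≠ (0 : grassRing d r) := by
  constructor
  · rw [eDimZ_eq κ hκ, sub_nonneg]
    have h1 := LinearIndependent.fintype_card_le_finrank h
    rw [Module.finrank_matrix, Module.finrank_self, mul_one, Fintype.card_fin] at h1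
    have h2 : Fintype.card {x : Fin s × Fin d × Fin r | x.2 ∈ boxes (κ x.1)} =
        ∑ j, (boxes (κ j)).card := by
      rw [← Finset.card_sigma, ← Fintype.card_coe]
      exact Fintype.card_congr
        ⟨fun x => ⟨⟨x.1.1, x.1.2⟩, Finset.mem_sigma.2 ⟨Finset.mem_univ _, x.2⟩⟩,
          fun x => ⟨(x.1.1, x.1.2), (Finset.mem_sigma.1 x.2).2⟩,
          fun _ => rfl, fun _ => rfl⟩
    rw [h2] at h1
    have : (r : ℤ) - d = Fintype.card B := by omega
    rw [this]
    exact_mod_cast h1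
  · intro h0
    choose v hv hvm hrow using fun j => exists_isStacked (hκ j)
    choose f hf hf' using fun j => exists_model_stackVec (hg j) (β j) _ (v j) (hv j)
    have hfj : ∀ j, f j = map (Int.castRingHom K) (schurI (κ j)) := by
      intro j
      apply mul_left_cancel₀ (alt_stair_ne_zero K d)
      rw [hf' j, hrow j, ← map_alt (Int.castRingHom K) (stair d), ← map_mul, mul_comm,
        schurI_mul_alt, map_alt]
    have hm := Model.prod (fun i j => glOp_mul _) (fun i j => by rw [glOp_apply, extDer_one]) hf
    obtain ⟨n, hn, hn'⟩ := hm.exists_coeff_ne_zero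
      (glRel_glOp (G := fun i j => single i j (1 : K)) fun i j k l => by
        split_ifs with h <;> simp [h])
      (prod_stackVec_ne_zero g β v (fun j => (hv j).1) hvm h)
      (q := Fintype.card B) (fun i u c => glOp_diag_bound i)
    apply hn
    have h2 := coeff_prod_schurI_mul_alt hd hd0 κ h0 n fun i => by have := hn' i; omega
    rw [Finset.prod_congr rfl fun j _ => hfj j, ← map_prod, ← map_alt (Int.castRingHom K),
      ← map_mul, coeff_map, mul_comm, h2, map_zero]

end SchubertAlg

namespace SchubertAlg

lemma exists_ringHom_lift {S F B : Type*} [CommRing S] [CommRing F] [Algebra S F]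
    [Algebra.FormallySmooth S F] [CommRing B] (ψ : S →+* B) (π : B →+* F)
    (hπ : Function.Surjective π) (hk : IsNilpotent (RingHom.ker π))
    (h : π.comp ψ = algebraMap S F) :
    ∃ L : F →+* B, π.comp L = RingHom.id F ∧ L.comp (algebraMap S F) = ψ := by
  let _ := ψ.toAlgebra
  let π' : B →ₐ[S] F := ⟨π, fun x => DFunLike.congr_fun h x⟩
  let L := Algebra.FormallySmooth.liftOfSurjective (AlgHom.id S F) π' hπ hk
  exact ⟨L, RingHom.ext fun x => Algebra.FormallySmooth.liftOfSurjective_apply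
    (AlgHom.id S F) π' hπ hk x, RingHom.ext fun x => L.commutes x⟩

lemma formallyEtale_of_isAlgebraic {S F : Type*} [CommRing S] [Field F] [CharZero F]
    [Algebra S F] [FaithfulSMul S F] [Algebra.IsAlgebraic S F] :
    Algebra.FormallyEtale S F := by
  have : IsDomain S := (FaithfulSMul.algebraMap_injective S F).isDomain _
  let _ := FractionRing.liftAlgebra S F
  have : CharZero (FractionRing S) :=
    (RingHom.charZero_iff (algebraMap (FractionRing S) F).injective).2 inferInstance
  have : Algebra.IsAlgebraic (FractionRing S) F :=
    (IsFractionRing.comap_isAlgebraic_iff (A := S)).1 inferInstance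
  have := Algebra.FormallyEtale.of_isLocalization (Rₘ := FractionRing S) (nonZeroDivisors S)
  have := Algebra.FormallyEtale.of_isSeparable (FractionRing S) F
  exact .comp S (FractionRing S) F

/-- In characteristic zero there are derivations with prescribed values on an algebraically
independent family. -/
theorem exists_derivation {F Z : Type*} [Field F] [CharZero F] {Φ : Z → F}
    (hΦ : AlgebraicIndependent ℤ Φ) (t : Z → F) : ∃ D : Derivation ℤ F F, ∀ z, D (Φ z) = t z := by
  obtain ⟨T, hT, hb⟩ := exists_isTranscendenceBasis_superset (s := Set.range Φ) hΦ.coe_range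
  have := hb.isAlgebraic
  have := formallyEtale_of_isAlgebraic (S := Algebra.adjoin ℤ (Set.range (Subtype.val : T → F)))
    (F := F)
  classical
  let τ : T → F := fun x => if h : ∃ z, Φ z = x then t h.choose else 0
  have hτ : ∀ z, τ ⟨Φ z, hT ⟨z, rfl⟩⟩ = t z := by
    intro z
    have h : ∃ y, Φ y = Φ z := ⟨z, rfl⟩
    simp only [τ, dif_pos h]
    rw [hΦ.injective h.choose_spec]
  let ψ : MvPolynomial T ℤ →ₐ[ℤ] TrivSqZeroExt F F :=
    MvPolynomial.aeval fun x => TrivSqZeroExt.inl x.1 + TrivSqZeroExt.inr (τ x)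
  have hψ : ∀ p, (ψ p).fst = MvPolynomial.aeval (Subtype.val : T → F) p := by
    intro p
    have : (TrivSqZeroExt.fstHom ℤ F F).comp ψ = MvPolynomial.aeval (Subtype.val : T → F) := by
      ext x
      simp [ψ]
    exact DFunLike.congr_fun this p
  obtain ⟨L, hL1, hL2⟩ := exists_ringHom_lift
    (S := Algebra.adjoin ℤ (Set.range (Subtype.val : T → F)))
    (ψ.toRingHom.comp (hb.1.aevalEquiv.symm : _ →+* MvPolynomial T ℤ))
    (TrivSqZeroExt.fstHom ℤ F F : TrivSqZeroExt F F →+* F) (fun x => ⟨TrivSqZeroExt.inl x, rfl⟩)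
    ⟨2, TrivSqZeroExt.kerIdeal_sq F F⟩ (by
      ext x
      obtain ⟨p, rfl⟩ := hb.1.aevalEquiv.surjective x
      simpa using hψ p)
  have hfst : ∀ x, (L x).fst = x := fun x => DFunLike.congr_fun hL1 x
  refine ⟨Derivation.mk' (AddMonoidHom.toIntLinearMap
    { toFun := fun x => (L x).snd, map_zero' := by simp, map_add' := by simp }) ?_, ?_⟩
  · intro a b
    simp [hfst, mul_comm]
  · intro z
    have h := DFunLike.congr_fun hL2 (hb.1.aevalEquiv (MvPolynomial.X ⟨Φ z, hT ⟨z, rfl⟩⟩))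
    have h' : algebraMap (Algebra.adjoin ℤ (Set.range (Subtype.val : T → F))) F
        (hb.1.aevalEquiv (MvPolynomial.X ⟨Φ z, hT ⟨z, rfl⟩⟩)) = Φ z := by
      simp
    rw [RingHom.comp_apply, h'] at h
    change (L (Φ z)).snd = _
    rw [h]
    simp [ψ, hτ]

end SchubertAlg

namespace SchubertAlg

open Matrix

section

variable {F : Type*} [Field F] {d r : ℕ} (hd : d ≤ r)

lemma sum_castLE {M : Type*} [AddCommMonoid M] (f : Fin r → M) (hf : ∀ i : Fin r, d ≤ i → f i = 0) :
    ∑ a : Fin d, f (Fin.castLE hd a) = ∑ i, f i :=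
  Fintype.sum_of_injective _ (Fin.castLE_injective hd) _ _
    (fun i hi => hf i (by
      by_contra! h
      exact hi ⟨⟨i, h⟩, rfl⟩)) fun _ => rfl

variable {κ : Fin d → Fin r} {C : Matrix (Fin r) (Fin r) F}

lemma inv_submatrix_mul (hκ : Function.Injective κ) (hC : IsUnit C.det)
    (hz : ∀ i : Fin r, d ≤ i → ∀ t, C i (κ t) = 0) :
    C⁻¹.submatrix κ (Fin.castLE hd) * C.submatrix (Fin.castLE hd) κ = 1 := by
  ext t t'
  rw [mul_apply]
  simp only [submatrix_apply]
  rw [sum_castLE hd (fun i => C⁻¹ (κ t) i * C i (κ t')) (fun i hi => by simp [hz i hi]),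
    ← mul_apply, nonsing_inv_mul _ hC]
  simp [one_apply, hκ.eq_iff]

lemma isUnit_frame_det (hκ : Function.Injective κ) (hC : IsUnit C.det)
    (hz : ∀ i : Fin r, d ≤ i → ∀ t, C i (κ t) = 0) :
    IsUnit (C.submatrix (Fin.castLE hd) κ).det :=
  isUnit_iff_ne_zero.2 (det_ne_zero_of_left_inverse (inv_submatrix_mul hd hκ hC hz))

lemma inv_apply_castLE (hκ : Function.Injective κ) (hC : IsUnit C.det)
    (hz : ∀ i : Fin r, d ≤ i → ∀ t, C i (κ t) = 0) {u : Fin r} (hu : ∀ t, κ t ≠ u) (a : Fin d) :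
    C⁻¹ u (Fin.castLE hd a) = 0 := by
  have h := eq_zero_of_vecMul_eq_zero (isUnit_frame_det hd hκ hC hz).ne_zero
    (v := fun a => C⁻¹ u (Fin.castLE hd a)) (by
      ext t
      simp only [vecMul, dotProduct, submatrix_apply, Pi.zero_apply]
      rw [sum_castLE hd (fun i => C⁻¹ u i * C i (κ t)) (fun i hi => by simp [hz i hi]),
        ← mul_apply, nonsing_inv_mul _ hC, one_apply_ne (hu t).symm])
  exact congrFun h a

end

lemma map_derivation_mul {F : Type*} [CommRing F] {n : Type*} [Fintype n] (D : Derivation ℤ F F)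
    (A B : Matrix n n F) : (A * B).map D = A.map D * B + A * B.map D := by
  ext i j
  simp [mul_apply, Finset.sum_add_distrib, add_comm, mul_comm]

/-- If the entries of a family of products `g * C j * T j` have arbitrary derivatives, then the
conormal spaces of the Schubert cells attached to the `C j` are linearly independent. -/
theorem linearIndepOn_of_derivation {F : Type*} [Field F] {d r s : ℕ} (hd : d ≤ r)
    (κ : Fin s → Fin d → Fin r) (hκ : ∀ j, Function.Injective (κ j))
    (g : Matrix (Fin r) (Fin r) F) (C T : Fin s → Matrix (Fin r) (Fin r) F)
    (hg : IsUnit g.det) (hC : ∀ j, IsUnit (C j).det) (hT : ∀ j, IsUnit (T j).det)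
    (hCz : ∀ j, ∀ i : Fin r, d ≤ i → ∀ t, C j i (κ j t) = 0)
    (hTz : ∀ j a b, b < a → T j a b = 0)
    (hD : ∀ t : Fin s → Matrix (Fin r) (Fin r) F,
      ∃ D : Derivation ℤ F F, ∀ j, (g * C j * T j).map D = t j) :
    LinearIndepOn F (fun x : Fin s × Fin d × Fin r =>
      vecMulVec (fun a => (C x.1).submatrix (Fin.castLE hd) (κ x.1) a x.2.1)
        (fun b : {i : Fin r // d ≤ i} => (C x.1)⁻¹ x.2.2 b)) {x | x.2 ∈ boxes (κ x.1)} := by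
  classical
  choose D hD using fun x : Fin s × Fin d × Fin r => hD fun j =>
    g * C j * (if j = x.1 then single x.2.2 (κ x.1 x.2.1) 1 else 0) * T j
  let X : Fin s × Fin d × Fin r → Matrix (Fin r) (Fin r) F := fun x => g⁻¹ * g.map (D x)
  have key : ∀ x j, (if j = x.1 then single x.2.2 (κ x.1 x.2.1) (1 : F) else 0) =
      (C j)⁻¹ * X x * C j + (C j)⁻¹ * (C j).map (D x) + (T j).map (D x) * (T j)⁻¹ := by
    intro x j
    have h := hD x j
    rw [map_derivation_mul, map_derivation_mul] at h
    have h2 := congrArg (fun M => (C j)⁻¹ * (g⁻¹ * M) * (T j)⁻¹) h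
    simp only [Matrix.mul_add, Matrix.add_mul, Matrix.mul_assoc, mul_nonsing_inv _ (hT j),
      Matrix.mul_one] at h2
    simp only [← Matrix.mul_assoc, nonsing_inv_mul _ hg, Matrix.one_mul] at h2
    simp only [nonsing_inv_mul _ (hC j), Matrix.one_mul] at h2
    rw [← h2]
    simp only [X, Matrix.mul_assoc]
  have hval : ∀ x j, ∀ p ∈ boxes (κ j), ((C j)⁻¹ * X x * C j) p.2 (κ j p.1) =
      if x = (j, p) then 1 else 0 := by
    rintro ⟨j', t', u'⟩ j ⟨t, u⟩ hp
    rw [mem_boxes] at hp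
    obtain ⟨hu, htu⟩ := hp
    dsimp only at hu htu ⊢
    have h := congrFun (congrFun (key (j', t', u') j) u) (κ j t)
    have h1 : ((C j)⁻¹ * (C j).map (D (j', t', u'))) u (κ j t) = 0 := by
      rw [mul_apply]
      refine Finset.sum_eq_zero fun i _ => ?_
      by_cases hi : d ≤ i
      · simp [hCz j i hi]
      · rw [show i = Fin.castLE hd ⟨i, by omega⟩ from rfl,
          inv_apply_castLE hd (hκ j) (hC j) (hCz j) hu, zero_mul]
    have h2 : ((T j).map (D (j', t', u')) * (T j)⁻¹) u (κ j t) = 0 := by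
      let _ := invertibleOfIsUnitDet (T j) (hT j)
      have hb : (T j).BlockTriangular id := fun a b hab => hTz j a b hab
      have hb' : ((T j).map (D (j', t', u'))).BlockTriangular id := fun a b hab => by
        simp [hTz j a b hab]
      exact hb'.mul (blockTriangular_inv_of_blockTriangular hb) htu
    rw [Matrix.add_apply, Matrix.add_apply, h1, h2, add_zero, add_zero] at h
    rw [← h]
    dsimp only
    by_cases hj : j = j'
    · subst hj
      simp [single_apply, (hκ j).eq_iff, and_comm]
    · simp [hj, Ne.symm hj]
  let ℓ : Fin s × Fin d × Fin r → Module.Dual F (Matrix (Fin d) {i : Fin r // d ≤ i} F) := fun x =>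
    ∑ a, ∑ b, X x b.1 (Fin.castLE hd a) • entryLinearMap F F a b
  have hℓ : ∀ x y, y.2 ∈ boxes (κ y.1) → ℓ x (vecMulVec
      (fun a => (C y.1).submatrix (Fin.castLE hd) (κ y.1) a y.2.1)
        (fun b : {i : Fin r // d ≤ i} => (C y.1)⁻¹ y.2.2 b)) = if x = y then 1 else 0 := by
    intro x y hy
    rw [← hval x y.1 y.2 hy, mul_apply]
    have hu := (mem_boxes.1 hy).1
    rw [← sum_castLE hd _ fun i hi => by rw [hCz y.1 i hi, mul_zero]]
    simp only [ℓ, LinearMap.sum_apply, LinearMap.smul_apply, entryLinearMap_apply, vecMulVec_apply,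
      submatrix_apply, smul_eq_mul, mul_apply, Finset.sum_mul]
    refine Finset.sum_congr rfl fun a _ => ?_
    refine (Fintype.sum_of_injective _ Subtype.val_injective _ _ (fun i hi => ?_) fun b => ?_)
    · have : ¬ d ≤ i := fun h => hi ⟨⟨i, h⟩, rfl⟩
      rw [show i = Fin.castLE hd ⟨i, by omega⟩ from rfl,
        inv_apply_castLE hd (hκ _) (hC _) (hCz _) hu, zero_mul, zero_mul]
    · ring
  refine LinearIndependent.of_pairwise_dual_eq_zero_one _ (fun x => ℓ x.1) (fun x y hxy => ?_)
    fun x => ?_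
  · dsimp only
    rw [hℓ _ _ y.2, if_neg (by simpa [Subtype.ext_iff] using hxy)]
  · dsimp only
    rw [hℓ _ _ x.2, if_pos rfl]

end SchubertAlg

namespace SchubertAlg

open Matrix

/-- The matrix indexed by `c` in a family of `r × r` matrices with prescribed entries. -/
def parMat {I A : Type*} {r : ℕ} (x : I × Fin r × Fin r → A) (c : I) :
    Matrix (Fin r) (Fin r) A := of fun a b => x (c, a, b)

/-- The indices of the matrices `g`, `C j` and `T j` used to parametrise tuples of bases together
with a subspace in given relative positions. -/
abbrev ParIdx (s : ℕ) : Type := Unit ⊕ Fin s ⊕ Fin s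

section

variable {A : Type*} [CommRing A] {d r s : ℕ} (κ : Fin s → Fin d → Fin r)
  (x : ParIdx s × Fin r × Fin r → A)

open Classical in
/-- The matrix `C j`, whose columns indexed by `κ j` are supported on the first `d` rows. -/
def parC (j : Fin s) : Matrix (Fin r) (Fin r) A :=
  of fun i a => if d ≤ (i : ℕ) ∧ ∃ t, κ j t = a then 0 else parMat x (.inr (.inl j)) i a

/-- The upper triangular matrix `T j`. -/
def parT (j : Fin s) : Matrix (Fin r) (Fin r) A :=
  of fun a b => if b < a then 0 else parMat x (.inr (.inr j)) a b

/-- The entries of the matrices `g * C j * T j`. -/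
def parM (z : Fin s × Fin r × Fin r) : A :=
  (parMat x (.inl ()) * parC κ x z.1 * parT x z.1) z.2.1 z.2.2

variable {B : Type*} [CommRing B] (f : A →+* B)

lemma map_parMat (c : ParIdx s) : (parMat x c).map f = parMat (f ∘ x) c := rfl

lemma map_parC (j : Fin s) : (parC κ x j).map f = parC κ (f ∘ x) j := by
  ext i a
  simp only [parC, map_apply, of_apply, apply_ite f, map_zero]
  rfl

lemma map_parT (j : Fin s) : (parT x j).map f = parT (f ∘ x) j := by
  ext i a
  simp only [parT, map_apply, of_apply, apply_ite f, map_zero]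
  rfl

lemma map_parM (z : Fin s × Fin r × Fin r) : f (parM κ x z) = parM κ (f ∘ x) z := by
  rw [parM, parM, ← map_parMat, ← map_parC, ← map_parT, ← Matrix.map_mul, ← Matrix.map_mul]
  rfl

end

lemma isUnit_det_map {σ F : Type*} [Field F] {φ : MvPolynomial σ ℤ →+* F}
    (hφ : Function.Injective φ) {n : Type*} [Fintype n] [DecidableEq n]
    (M : Matrix n n (MvPolynomial σ ℤ)) (x : σ → ℤ)
    (h : (M.map (MvPolynomial.eval x)).det ≠ 0) : IsUnit (M.map φ).det := by
  rw [isUnit_iff_ne_zero, ← RingHom.mapMatrix_apply, ← RingHom.map_det]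
  refine (map_ne_zero_iff _ hφ).2 fun h0 => h ?_
  rw [← RingHom.mapMatrix_apply, ← RingHom.map_det, h0, map_zero]

lemma eval_comp_X {σ A : Type*} [CommRing A] (x : σ → A) :
    MvPolynomial.eval x ∘ MvPolynomial.X = x := by
  ext z
  simp

section

variable {d r s : ℕ} {κ : Fin s → Fin d → Fin r}

lemma exists_det_parMat_ne_zero (c : ParIdx s) :
    ∃ x : ParIdx s × Fin r × Fin r → ℤ, (parMat x c).det ≠ 0 := by
  refine ⟨fun z => (1 : Matrix _ _ ℤ) z.2.1 z.2.2, ?_⟩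
  have : parMat (fun z : ParIdx s × Fin r × Fin r => (1 : Matrix _ _ ℤ) z.2.1 z.2.2) c = 1 := rfl
  simp [this]

lemma exists_det_parT_ne_zero (j : Fin s) :
    ∃ x : ParIdx s × Fin r × Fin r → ℤ, (parT x j).det ≠ 0 := by
  refine ⟨fun z => (1 : Matrix _ _ ℤ) z.2.1 z.2.2, ?_⟩
  have : parT (fun z : ParIdx s × Fin r × Fin r => (1 : Matrix _ _ ℤ) z.2.1 z.2.2) j = 1 := by
    ext a b
    simp only [parT, parMat, of_apply]
    split_ifs with h
    · rw [one_apply_ne h.ne']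
    · rfl
  simp [this]

lemma exists_det_parC_ne_zero (hd : d ≤ r) (j : Fin s) (hκ : Function.Injective (κ j)) :
    ∃ x : ParIdx s × Fin r × Fin r → ℤ, (parC κ x j).det ≠ 0 := by
  obtain ⟨σ, hσ⟩ := Equiv.Perm.exists_extending_pair (κ j) (Fin.castLE hd) hκ
    (Fin.castLE_injective hd)
  refine ⟨fun z => (1 : Matrix _ _ ℤ) z.2.1 (σ z.2.2), ?_⟩
  have : parC κ (fun z : ParIdx s × Fin r × Fin r => (1 : Matrix _ _ ℤ) z.2.1 (σ z.2.2)) j =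
      (1 : Matrix _ _ ℤ).submatrix id σ := by
    ext i a
    simp only [parC, parMat, of_apply, submatrix_apply]
    split_ifs with h
    · obtain ⟨hi, t, rfl⟩ := h
      have : σ (κ j t) = Fin.castLE hd t := by simpa using hσ t
      rw [this, one_apply_ne]
      rintro rfl
      exact absurd hi (by simp)
    · rfl
  rw [this, det_permute', det_one, mul_one]
  simp

theorem nonneg_and_prod_ne_zero_of_injective (hd0 : 0 < d) (hd : d ≤ r)
    (hκ : ∀ j, StrictMono (κ j)) {F : Type*} [Field F] [CharZero F]
    {φ : MvPolynomial (ParIdx s × Fin r × Fin r) ℤ →+* F} (hφ : Function.Injective φ)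
    (h : AlgebraicIndependent ℤ
      (parM κ (MvPolynomial.X : ParIdx s × Fin r × Fin r → MvPolynomial _ ℤ))) :
    0 ≤ eDimZ r d κ ∧ ∏ j, omegaCls (κ j) ≠ (0 : grassRing d r) := by
  set y : ParIdx s × Fin r × Fin r → F := φ ∘ MvPolynomial.X with hy
  have hg : IsUnit (parMat y (.inl ())).det := by
    obtain ⟨x, hx⟩ := exists_det_parMat_ne_zero (s := s) (r := r) (.inl ())
    rw [hy, ← map_parMat]
    exact isUnit_det_map hφ _ x (by rwa [map_parMat, eval_comp_X])
  have hT : ∀ j, IsUnit (parT y j).det := fun j => by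
    obtain ⟨x, hx⟩ := exists_det_parT_ne_zero (r := r) j
    rw [hy, ← map_parT]
    exact isUnit_det_map hφ _ x (by rwa [map_parT, eval_comp_X])
  have hC : ∀ j, IsUnit (parC κ y j).det := fun j => by
    obtain ⟨x, hx⟩ := exists_det_parC_ne_zero hd j (hκ j).injective
    rw [hy, ← map_parC]
    exact isUnit_det_map hφ _ x (by rwa [map_parC, eval_comp_X])
  have hCz : ∀ j, ∀ i : Fin r, d ≤ i → ∀ t, parC κ y j i (κ j t) = 0 := by
    intro j i hi t
    simp [parC, hi]
  have hB : Fintype.card {i : Fin r // d ≤ i} + d = r := by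
    have h1 := Fintype.card_subtype_compl (fun i : Fin r => (i : ℕ) < d)
    have h2 : Fintype.card {i : Fin r // (i : ℕ) < d} = d := by
      rw [Fintype.card_subtype, Fin.card_filter_val_lt]; omega
    simp only [not_lt] at h1
    rw [h1, h2, Fintype.card_fin]
    omega
  have hTz : ∀ j a b, b < a → parT y j a b = 0 := fun j a b hab => by simp [parT, hab]
  have hy' : parM κ y = φ ∘ parM κ MvPolynomial.X := by
    ext z
    exact (map_parM κ _ _ z).symm
  have hD : ∀ t : Fin s → Matrix (Fin r) (Fin r) F, ∃ D : Derivation ℤ F F,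
      ∀ j, (parMat y (.inl ()) * parC κ y j * parT y j).map D = t j := by
    intro t
    obtain ⟨D, hD⟩ := exists_derivation (Φ := parM κ y)
      (by rw [hy']; exact h.map' (f := φ.toIntAlgHom) hφ) fun z => t z.1 z.2.1 z.2.2
    exact ⟨D, fun j => by ext a b; exact hD (j, a, b)⟩
  clear_value y
  have hli := linearIndepOn_of_derivation hd κ (fun j => (hκ j).injective) (parMat y (.inl ()))
    (parC κ y) (parT y) hg hC hT hCz hTz hD
  exact eDimZ_nonneg_and_prod_ne_zero hd0 hd κ hκ hB
    (fun j => (parC κ y j).submatrix (Fin.castLE hd) (κ j))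
    (fun j => isUnit_frame_det hd (hκ j).injective (hC j) (hCz j))
    (fun j u b => (parC κ y j)⁻¹ u b) hli

/-- If the generic products `g * C j * T j` are dominant, then the expected dimension is nonnegative
and the product of Schubert classes does not vanish. -/
theorem nonneg_and_prod_ne_zero_of_algebraicIndependent (hd0 : 0 < d) (hd : d ≤ r)
    (hκ : ∀ j, StrictMono (κ j))
    (h : AlgebraicIndependent ℤ
      (parM κ (MvPolynomial.X : ParIdx s × Fin r × Fin r → MvPolynomial _ ℤ))) :
    0 ≤ eDimZ r d κ ∧ ∏ j, omegaCls (κ j) ≠ (0 : grassRing d r) := by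
  have hφ := IsFractionRing.injective (MvPolynomial (ParIdx s × Fin r × Fin r) ℤ)
    (FractionRing (MvPolynomial (ParIdx s × Fin r × Fin r) ℤ))
  exact nonneg_and_prod_ne_zero_of_injective hd0 hd hκ hφ h

/-- If the generic products `g * C j * T j` are algebraically dependent, then their entries satisfy
a nontrivial polynomial relation over any field. -/
theorem exists_relation {k : Type*} [Field k] (h : ¬ AlgebraicIndependent ℤ
      (parM κ (MvPolynomial.X : ParIdx s × Fin r × Fin r → MvPolynomial _ ℤ))) :
    ∃ f : MvPolynomial (Fin s × Fin r × Fin r) k, f ≠ 0 ∧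
      ∀ x : ParIdx s × Fin r × Fin r → k, MvPolynomial.eval (parM κ x) f = 0 := by
  classical
  rw [algebraicIndependent_iff] at h
  push Not at h
  obtain ⟨f₀, hf₀, hf₀'⟩ := h
  obtain ⟨m₀, hm₀⟩ := MvPolynomial.ne_zero_iff.1 hf₀'
  let Q : ℕ → Prop := fun N => ∃ f : MvPolynomial (Fin s × Fin r × Fin r) ℤ, ∃ m,
    MvPolynomial.aeval (parM κ MvPolynomial.X : _ → MvPolynomial (ParIdx s × Fin r × Fin r) ℤ) f = 0
      ∧ f.coeff m ≠ 0 ∧ (f.coeff m).natAbs = N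
  have hQ : ∃ N, Q N := ⟨_, f₀, m₀, hf₀, hm₀, rfl⟩
  obtain ⟨f, m, hf, hm, hN⟩ := Nat.find_spec hQ
  refine ⟨MvPolynomial.map (Int.castRingHom k) f, fun h0 => ?_, fun x => ?_⟩
  · have hp := ringChar.charP k
    have hdvd : MvPolynomial.C (ringChar k : ℤ) ∣ f := by
      rw [MvPolynomial.C_dvd_iff_dvd_coeff]
      intro i
      rw [← CharP.intCast_eq_zero_iff k]
      simpa [MvPolynomial.coeff_map] using congrArg (MvPolynomial.coeff i) h0
    obtain ⟨f', rfl⟩ := hdvd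
    rw [MvPolynomial.coeff_C_mul] at hm hN
    have hp0 : (ringChar k : ℤ) ≠ 0 := left_ne_zero_of_mul hm
    have hm' := right_ne_zero_of_mul hm
    refine Nat.find_min hQ (m := (f'.coeff m).natAbs) ?_ ⟨f', m, ?_, hm', rfl⟩
    · rw [← hN, Int.natAbs_mul, Int.natAbs_natCast]
      have h1 : ringChar k ≠ 1 := CharP.ringChar_ne_one
      have h2 : 0 < (f'.coeff m).natAbs := Int.natAbs_pos.2 hm'
      have h3 : 1 < ringChar k := by
        have : ringChar k ≠ 0 := by exact_mod_cast hp0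
        omega
      nlinarith
    · rw [map_mul, MvPolynomial.aeval_C] at hf
      refine (mul_eq_zero.1 hf).resolve_left ?_
      simpa using hp0
  · have h1 := congrArg (MvPolynomial.eval₂Hom (Int.castRingHom k) x) hf
    rw [map_zero] at h1
    rw [MvPolynomial.eval_map, ← h1, MvPolynomial.aeval_def, MvPolynomial.hom_eval₂]
    congr 1
    · exact RingHom.ext_int _ _
    · ext z
      rw [map_parM]
      congr 1
      ext w
      simp

end

end SchubertAlg

namespace SchubertAlg

open Matrix

variable {k V : Type*} [Field k] [AddCommGroup V] [Module k V] {d r s : ℕ}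

lemma exists_basis_adapted [FiniteDimensional k V] (hV : finrank k V = r) {S : Submodule k V}
    (hS : finrank k S = d) :
    ∃ w : Basis (Fin r) k V, ∀ v ∈ S, ∀ i : Fin r, d ≤ i → w.repr v i = 0 := by
  obtain ⟨S', hS'⟩ := S.exists_isCompl
  have h' := Submodule.finrank_add_eq_of_isCompl hS'
  obtain ⟨e, rfl⟩ : ∃ e, r = d + e := ⟨finrank k S', by omega⟩
  have he : finrank k S' = e := by omega
  let w := ((((finBasisOfFinrankEq k S hS).prod (finBasisOfFinrankEq k S' he)).map
    (S.prodEquivOfIsCompl S' hS')).reindex finSumFinEquiv)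
  refine ⟨w, fun v hv i hi => ?_⟩
  have h1 : (S.prodEquivOfIsCompl S' hS').symm v = (⟨v, hv⟩, 0) := by
    rw [LinearEquiv.symm_apply_eq]
    simp
  obtain ⟨u, rfl⟩ : ∃ u : Fin e, i = Fin.natAdd d u := ⟨⟨i - d, by omega⟩, by ext; simp; omega⟩
  simp [w, h1]

/-- A subspace in the Schubert cell of `κ` meets the flag of `b` in vectors with leading term
`b (κ t)`. -/
lemma exists_leading_vector {κ : Fin d → Fin r} {S : Submodule k V} (b : Basis (Fin r) k V)
    (h : cellMem κ (spanFlag k b) S) (t : Fin d) :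
    ∃ v ∈ S, b.repr v (κ t) ≠ 0 ∧ ∀ a, κ t < a → b.repr v a = 0 := by
  have : FiniteDimensional k V := b.finiteDimensional_of_finite
  have hlt : finrank k ↥(S ⊓ spanFlag k b (κ t)) < finrank k ↥(S ⊓ spanFlag k b (κ t + 1)) := by
    rw [h.2 _ (by omega), h.2 _ (by omega)]
    refine Finset.card_lt_card (Finset.ssubset_iff_of_subset ?_ |>.2 ⟨t, by simp, by simp⟩)
    intro a ha
    simp only [Finset.mem_filter, Finset.mem_univ, true_and] at ha ⊢
    omega
  obtain ⟨v, hv, hv'⟩ : ∃ v ∈ S ⊓ spanFlag k b (κ t + 1), v ∉ S ⊓ spanFlag k b (κ t) := by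
    by_contra! hle
    exact hlt.not_ge (Submodule.finrank_mono hle)
  have h1 : ∀ a, κ t < a → b.repr v a = 0 := by
    intro a ha
    by_contra h0
    have := (b.mem_span_image).1 hv.2 (Finsupp.mem_support_iff.2 h0)
    simp only [Set.mem_ofPred_eq] at this
    omega
  refine ⟨v, hv.1, fun h0 => hv' ⟨hv.1, (b.mem_span_image).2 fun a ha => ?_⟩, h1⟩
  by_contra hle
  rw [Set.mem_ofPred_eq, not_lt] at hle
  refine Finsupp.mem_support_iff.1 ha ?_
  rcases hle.eq_or_lt with heq | hlt
  · rwa [← Fin.ext heq]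
  · exact h1 a hlt

/-- Tuples of bases for which some `d`-dimensional subspace has the relative positions `κ` are
products `g * C j * T j`. -/
theorem exists_eq_parM [FiniteDimensional k V] (e : Basis (Fin r) k V) {S : Submodule k V}
    (hS : finrank k S = d) {κ : Fin s → Fin d → Fin r} (hκ : ∀ j, Function.Injective (κ j))
    (b : Fin s → Basis (Fin r) k V) (h : ∀ j, cellMem (κ j) (spanFlag k (b j)) S) :
    ∃ x : ParIdx s × Fin r × Fin r → k, ∀ z, e.repr (b z.1 z.2.2) z.2.1 = parM κ x z := by
  obtain ⟨w, hw⟩ := exists_basis_adapted (by simpa using finrank_eq_card_basis e) hS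
  choose v hvS hv hv0 using fun j t => exists_leading_vector (b j) (h j) t
  let b' : Fin s → Fin r → V := fun j => Function.extend (κ j) (v j) (b j)
  have hb'κ : ∀ j t, b' j (κ j t) = v j t := fun j t => (hκ j).extend_apply _ _ _
  have hb' : ∀ j a, (∀ t, κ j t ≠ a) → b' j a = b j a := fun j a ha =>
    Function.extend_apply' _ _ _ (by simpa using ha)
  let T : Fin s → Matrix (Fin r) (Fin r) k := fun j => (b j).toMatrix (b' j)
  have hT : ∀ j, (T j).BlockTriangular id := by
    intro j a c hca
    change (b j).repr (b' j c) a = 0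
    by_cases hc : ∀ t, κ j t ≠ c
    · rw [hb' j c hc, Basis.repr_self, Finsupp.single_apply, if_neg (show c ≠ a from ne_of_lt hca)]
    · push Not at hc
      obtain ⟨t, rfl⟩ := hc
      rw [hb'κ, hv0 j t a hca]
  have hTd : ∀ j, IsUnit (T j).det := by
    intro j
    rw [det_of_isUpperTriangular (hT j), isUnit_iff_ne_zero, Finset.prod_ne_zero_iff]
    intro a _
    change (b j).repr (b' j a) a ≠ 0
    by_cases hc : ∀ t, κ j t ≠ a
    · simp [hb' j a hc]
    · push Not at hc
      obtain ⟨t, rfl⟩ := hc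
      rw [hb'κ]
      exact hv j t
  refine ⟨fun y => Sum.elim (fun _ => e.toMatrix w) (Sum.elim (fun j => w.toMatrix (b' j))
    fun j => (T j)⁻¹) y.1 y.2.1 y.2.2, fun ⟨j, i, a⟩ => ?_⟩
  have hC : parC κ (fun y => Sum.elim (fun _ => e.toMatrix w)
      (Sum.elim (fun j => w.toMatrix (b' j)) fun j => (T j)⁻¹) y.1 y.2.1 y.2.2) j =
      w.toMatrix (b' j) := by
    ext i a
    simp only [parC, of_apply, parMat, Sum.elim_inr, Sum.elim_inl]
    split_ifs with hi
    · obtain ⟨hi, t, rfl⟩ := hi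
      rw [Basis.toMatrix_apply, hb'κ, hw _ (hvS j t) i hi]
    · rfl
  have hT' : parT (fun y => Sum.elim (fun _ => e.toMatrix w)
      (Sum.elim (fun j => w.toMatrix (b' j)) fun j => (T j)⁻¹) y.1 y.2.1 y.2.2) j = (T j)⁻¹ := by
    ext a c
    simp only [parT, of_apply, parMat, Sum.elim_inr]
    split_ifs with hac
    · let _ := invertibleOfIsUnitDet (T j) (hTd j)
      exact (blockTriangular_inv_of_blockTriangular (hT j) hac).symm
    · rfl
  rw [parM, hC, hT']
  have hM : e.toMatrix (b j) = e.toMatrix w * w.toMatrix (b' j) * (T j)⁻¹ := by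
    rw [Basis.toMatrix_mul_toMatrix, ← e.toMatrix_mul_toMatrix (b j) (b' j), mul_assoc,
      mul_nonsing_inv _ (hTd j), mul_one]
  exact congrFun (congrFun hM i) a

end SchubertAlg

namespace SchubertAlg

open Matrix

lemma nonneg_and_prod_ne_zero_of_zero {r s : ℕ} (κ : Fin s → Fin 0 → Fin r) :
    0 ≤ eDimZ r 0 κ ∧ ∏ j, omegaCls (κ j) ≠ (0 : grassRing 0 r) := by
  refine ⟨by simp [eDimZ], ?_⟩
  have h1 : ∀ j, omegaCls (κ j) = (1 : grassRing 0 r) := fun j => by simp [omegaCls, schurI]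
  have h2 : grassIdeal 0 r = ⊥ := by simp [grassIdeal]
  have : Nontrivial (grassRing 0 r) := Ideal.Quotient.nontrivial_iff.2 (by rw [h2]; exact bot_ne_top)
  simp [h1]

variable {k V : Type*} [Field k] [AddCommGroup V] [Module k V] {r s : ℕ}

/-- The coordinate functions on tuples of bases. -/
def coordFun (e : Basis (Fin r) k V) (z : Fin s × Fin r × Fin r) :
    Module.Dual k (Fin s → Fin r → V) :=
  e.coord z.2.1 ∘ₗ LinearMap.proj z.2.2 ∘ₗ LinearMap.proj z.1

lemma coordFun_apply (e : Basis (Fin r) k V) (z : Fin s × Fin r × Fin r) (b : Fin s → Fin r → V) :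
    coordFun e z b = e.repr (b z.1 z.2.2) z.2.1 := rfl

/-- A nonzero polynomial in the coordinates does not vanish on all tuples of bases. -/
lemma exists_linearIndependent_eval_ne_zero [Infinite k] (e : Basis (Fin r) k V)
    {f : MvPolynomial (Fin s × Fin r × Fin r) k} (hf : f ≠ 0) :
    ∃ b : Fin s → Fin r → V, MvPolynomial.eval (fun z => coordFun e z b) f ≠ 0 ∧
      ∀ j, LinearIndependent k (b j) := by
  let M : Fin s → Matrix (Fin r) (Fin r) (MvPolynomial (Fin s × Fin r × Fin r) k) := fun j =>
    of fun a c => MvPolynomial.X (j, a, c)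
  have heval : ∀ y j, MvPolynomial.eval y (M j).det = (of fun a c => y (j, a, c)).det := by
    intro y j
    rw [RingHom.map_det]
    congr 1
    ext a c
    simp [M]
  have hM : ∀ j, (M j).det ≠ 0 := fun j h0 => by
    have := heval (fun z => (1 : Matrix (Fin r) (Fin r) k) z.2.1 z.2.2) j
    rw [h0, map_zero] at this
    exact one_ne_zero ((det_one (n := Fin r) (R := k)).symm.trans this.symm)
  obtain ⟨y, hy⟩ : ∃ y, MvPolynomial.eval y (f * ∏ j, (M j).det) ≠ 0 := by
    by_contra! h
    exact mul_ne_zero hf (Finset.prod_ne_zero_iff.2 fun j _ => hM j)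
      (MvPolynomial.funext fun y => by rw [h, map_zero])
  rw [map_mul, map_prod] at hy
  have hb : ∀ z : Fin s × Fin r × Fin r,
      coordFun e z (fun j c => e.equivFun.symm fun a => y (j, a, c)) = y z := fun z => by
    simp [coordFun_apply, ← Basis.equivFun_apply, -Basis.equivFun_symm_apply]
  refine ⟨fun j c => e.equivFun.symm fun a => y (j, a, c), ?_, fun j => ?_⟩
  · simp only [hb]
    exact left_ne_zero_of_mul hy
  · have h := Finset.prod_ne_zero_iff.1 (right_ne_zero_of_mul hy) j (Finset.mem_univ _)
    rw [heval] at h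
    exact (linearIndependent_cols_of_det_ne_zero h).map' e.equivFun.symm.toLinearMap
      (LinearEquiv.ker _)

open Classical in
/-- A polynomial relation between the entries of `g * C j * T j` if there is one, and `1`
otherwise. -/
def relPoly (k : Type*) [Field k] {d : ℕ} (κ : Fin s → Fin d → Fin r) :
    MvPolynomial (Fin s × Fin r × Fin r) k :=
  if h : AlgebraicIndependent ℤ
    (parM κ (MvPolynomial.X : ParIdx s × Fin r × Fin r → MvPolynomial _ ℤ)) then 1
  else (exists_relation h).choose

lemma relPoly_ne_zero {d : ℕ} (κ : Fin s → Fin d → Fin r) : relPoly k κ ≠ 0 := by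
  rw [relPoly]
  split_ifs with h
  · exact one_ne_zero
  · exact (exists_relation h).choose_spec.1

lemma eval_relPoly {d : ℕ} {κ : Fin s → Fin d → Fin r} (h : ¬ AlgebraicIndependent ℤ
      (parM κ (MvPolynomial.X : ParIdx s × Fin r × Fin r → MvPolynomial _ ℤ)))
    (x : ParIdx s × Fin r × Fin r → k) : MvPolynomial.eval (parM κ x) (relPoly k κ) = 0 := by
  rw [relPoly, dif_neg h]
  exact (exists_relation h).choose_spec.2 x

theorem genericFlags [Infinite k] [FiniteDimensional k V] (hV : finrank k V = r) :
    GenericFlags k s r (fun F =>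
      ∀ (d : ℕ) (S : Submodule k V), Module.finrank k ↥S = d →
        ∀ K : Fin s → Fin d → Fin r, (∀ j, StrictMono (K j)) →
          (∀ j, cellMem (K j) (F j) S) →
          (0 : ℤ) ≤ eDimZ r d K ∧ (∏ j : Fin s, omegaCls (K j)) ≠ (0 : grassRing d r)) := by
  let e := finBasisOfFinrankEq k V hV
  let f : MvPolynomial (Fin s × Fin r × Fin r) k :=
    ∏ p : (Σ d : Fin (r + 1), Fin s → Fin d → Fin r), relPoly k p.2
  have hf : f ≠ 0 := Finset.prod_ne_zero_iff.2 fun p _ => relPoly_ne_zero _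
  have hU : ∀ b, mEval k b (MvPolynomial.rename (coordFun e) f) =
      MvPolynomial.eval (fun z => coordFun e z b) f := fun b => by
    rw [mEval, MvPolynomial.eval_rename]
    rfl
  refine ⟨{b | mEval k b (MvPolynomial.rename (coordFun e) f) ≠ 0},
    TopologicalSpace.isOpen_generateFrom_of_mem ⟨_, rfl⟩, ?_, ?_⟩
  · obtain ⟨b, hb, hb'⟩ := exists_linearIndependent_eval_ne_zero e hf
    exact ⟨b, by rwa [Set.mem_ofPred_eq, hU], hb'⟩
  · intro b hb hli d S hS κ hκ hcell
    rw [Set.mem_ofPred_eq, hU, map_prod, Finset.prod_ne_zero_iff] at hb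
    have hd : d ≤ r := hS ▸ hV ▸ Submodule.finrank_le S
    rcases Nat.eq_zero_or_pos d with rfl | hd0
    · exact nonneg_and_prod_ne_zero_of_zero κ
    by_cases h : AlgebraicIndependent ℤ
      (parM κ (MvPolynomial.X : ParIdx s × Fin r × Fin r → MvPolynomial _ ℤ))
    · exact nonneg_and_prod_ne_zero_of_algebraicIndependent hd0 hd hκ h
    · let B : Fin s → Basis (Fin r) k V := fun j =>
        basisOfLinearIndependentOfCardEqFinrank' (b j) (hli j) (by simp [hV])
      have hB : ∀ j, ⇑(B j) = b j := fun j => by simp [B]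
      obtain ⟨x, hx⟩ := exists_eq_parM e hS (fun j => (hκ j).injective) B
        fun j => by rw [hB]; exact hcell j
      refine absurd ?_ (hb ⟨⟨d, by omega⟩, κ⟩ (Finset.mem_univ _))
      convert! eval_relPoly h x with z
      rw [coordFun_apply, ← hx, hB]

end SchubertAlg

/-- Lemma `k1`.  Let `V` be `r`-dimensional and `𝓕` a generic point
of `Fl(V)^s`.  If `S ⊆ V` has dimension `d` and `𝓚` is the unique `s`-tuple of subsets
of `[r]` of cardinality `d` with `S ∈ ∩_j Ω°_{K^j}(F^j_•)`, then `dim(S,V,𝓕) ≥ 0` and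
`∏_j ω_{K^j} ≠ 0` in `H^*(Gr(d,V))`. -/
theorem stmt12 (k : Type) [Field k] [IsAlgClosed k]
    {V : Type} [AddCommGroup V] [Module k V] [FiniteDimensional k V]
    (r s : ℕ) (hs : 0 < s) (hV : Module.finrank k V = r) :
    GenericFlags k s r (fun F =>
      ∀ (d : ℕ) (S : Submodule k V), Module.finrank k ↥S = d →
        ∀ K : Fin s → Fin d → Fin r, (∀ j, StrictMono (K j)) →
          (∀ j, cellMem (K j) (F j) S) →
          (0 : ℤ) ≤ eDimZ r d K ∧ (∏ j : Fin s, omegaCls (K j)) ≠ (0 : grassRing d r)) := by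
  subst hV
  exact SchubertAlg.genericFlags rfl

end
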